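/- arXiv:math/0612795 — 2 statements merged into one kernel-verified Lean document; each statement's English description precedes it below -/
import Mathlib

section
/- Let n ≥ 1 and let U ⊆ ℝ^{2n} be an open subset. Suppose H_i : [0,1] × ℝ^{2n} → ℝ is a sequence of smooth functions for which there exists a single compact set K ⊂ ℝ^{2n} with supp H_i(t,·) ⊆ K for all i and all t ∈ [0,1]. Let φ_i : [0,1] × ℝ^{2n} → ℝ^{2n} be a Hamiltonian flow of H_i. Assume that H_i converges uniformly on [0,1] × ℝ^{2n} to a continuous function H, and that φ_i converges uniformly on [0,1] × ℝ^{2n} to a map λ : [0,1] × ℝ^{2n} → ℝ^{2n}. If there exists a continuous function c : [0,1] → ℝ such that H(t,x) = c(t) for all (t,x) ∈ [0,1] × U, then λ(t,x) = x for all (t,x) ∈ [0,1] × U. (This is the easy direction of the C⁰-locality theorem, instantiated on standard (ℝ^{2n}, ω₀).) -/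
open MeasureTheory

/-- Phase space `ℝ^{2n} = ℝⁿ × ℝⁿ` with coordinates `x = (q, p)`. -/
abbrev Phase (n : ℕ) := EuclideanSpace ℝ (Fin n) × EuclideanSpace ℝ (Fin n)

/-- The Hamiltonian vector field of `H`:
`X_H(t,(q,p)) = (∂H/∂p(t,q,p), −∂H/∂q(t,q,p))`. -/
noncomputable def hamVF {n : ℕ} (H : ℝ × Phase n → ℝ) (t : ℝ) (x : Phase n) : Phase n :=
  (gradient (fun p => H (t, (x.1, p))) x.2, - gradient (fun q => H (t, (q, x.2))) x.1)

/-- `φ` is a Hamiltonian flow of `H` on the time interval `[0,1]`: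
`φ(0,x) = x` and `t ↦ φ(t,x)` has derivative `X_H(t, φ(t,x))` at every `t ∈ [0,1]`. -/
def IsHamFlow {n : ℕ} (H : ℝ × Phase n → ℝ) (φ : ℝ × Phase n → Phase n) : Prop :=
  (∀ x, φ (0, x) = x) ∧
    ∀ x : Phase n, ∀ t ∈ Set.Icc (0:ℝ) 1,
      HasDerivAt (fun s => φ (s, x)) (hamVF H t (φ (t, x))) t

section LocalityAux

open Metric Set Filter Topology

/-- Extrapolation of `t ↦ det (1 + t B)` from finitely many nodes. -/
theorem exists_extrapolation_det {E : Type*} [NormedAddCommGroup E] [NormedSpace ℝ E]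
    [FiniteDimensional ℝ E] (η : ℝ) (hη : 0 < η) :
    ∃ (s : Finset ℕ) (v w : ℕ → ℝ), (∀ j ∈ s, 0 < v j ∧ v j < η) ∧ ∑ j ∈ s, w j = 1 ∧
      ∀ B : E →L[ℝ] E, (1 + B).det = ∑ j ∈ s, w j * (1 + v j • B).det := by
  classical
  set d := Module.finrank ℝ E
  let b := Module.finBasis ℝ E
  let s := Finset.range (d + 1)
  let v : ℕ → ℝ := fun j => η / (j + 2)
  have hinj : Set.InjOn v s := by
    intro i _ j _ h
    simp only [v] at h
    have : ((i : ℝ) + 2) = j + 2 := by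
      field_simp at h
      linarith
    exact_mod_cast (add_right_cancel this)
  refine ⟨s, v, fun j => (Lagrange.basis s v j).eval 1, fun j _ => ⟨by positivity, ?_⟩, ?_, ?_⟩
  · simp only [v]
    rw [div_lt_iff₀ (by positivity)]
    nlinarith [(Nat.cast_nonneg j : (0:ℝ) ≤ j)]
  · rw [← Polynomial.eval_finsetSum, Lagrange.sum_basis hinj ⟨0, by simp [s]⟩, Polynomial.eval_one]
  · intro B
    let M := LinearMap.toMatrix b b (B : E →ₗ[ℝ] E)
    let p : Polynomial ℝ := ((Polynomial.X : Polynomial ℝ) • M.map (Polynomial.C : ℝ → Polynomial ℝ) +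
      (1 : Matrix (Fin d) (Fin d) ℝ).map (Polynomial.C : ℝ → Polynomial ℝ)).det
    have hp : ∀ t : ℝ, p.eval t = (1 + t • B).det := by
      intro t
      have h1 : (1 + t • B).det = LinearMap.det (((1 + t • B : E →L[ℝ] E)) : E →ₗ[ℝ] E) := rfl
      rw [h1, ← LinearMap.det_toMatrix b]
      have h2 : LinearMap.toMatrix b b ((1 + t • B : E →L[ℝ] E) : E →ₗ[ℝ] E) = t • M + 1 := by
        have : ((1 + t • B : E →L[ℝ] E) : E →ₗ[ℝ] E) = LinearMap.id + t • (B : E →ₗ[ℝ] E) := by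
          ext; simp
        rw [this, map_add, map_smul, LinearMap.toMatrix_id, add_comm]
      rw [h2]
      simp only [p]
      rw [← Polynomial.coe_evalRingHom, RingHom.map_det]
      congr 1
      ext i j
      by_cases hij : i = j
      · subst hij
        simp only [RingHom.mapMatrix_apply, Matrix.map_apply, Matrix.add_apply, Matrix.smul_apply,
          Matrix.one_apply_eq, Polynomial.coe_evalRingHom, smul_eq_mul, Polynomial.eval_add,
          Polynomial.eval_mul, Polynomial.eval_X, Polynomial.eval_C]
      · simp only [RingHom.mapMatrix_apply, Matrix.map_apply, Matrix.add_apply, Matrix.smul_apply,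
          Matrix.one_apply_ne hij, Polynomial.coe_evalRingHom, smul_eq_mul, Polynomial.eval_add,
          Polynomial.eval_mul, Polynomial.eval_X, Polynomial.eval_C]
    have hdeg : p.degree < s.card := by
      refine lt_of_le_of_lt (Polynomial.degree_le_natDegree) ?_
      have := Polynomial.natDegree_det_X_add_C_le M (1 : Matrix (Fin d) (Fin d) ℝ)
      simp only [Fintype.card_fin] at this
      simp only [s, Finset.card_range]
      exact_mod_cast Nat.lt_succ_of_le this
    have h3 := Lagrange.eq_interpolate hinj hdeg
    have h4 := hp 1
    rw [one_smul] at h4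
    rw [← h4, h3, Lagrange.interpolate_apply, Polynomial.eval_finsetSum]
    refine Finset.sum_congr rfl fun j _ => ?_
    rw [Polynomial.eval_mul, Polynomial.eval_C, ← hp, mul_comm]

theorem range_eq_top_of_det_ne_zero {E : Type*} [NormedAddCommGroup E] [NormedSpace ℝ E]
    [FiniteDimensional ℝ E] (T : E →L[ℝ] E) (hT : T.det ≠ 0) : T.range = ⊤ := by
  have hker : LinearMap.ker (T : E →ₗ[ℝ] E) = ⊥ := by
    by_contra hcon
    exact hT (LinearMap.det_eq_zero_iff_ker_ne_bot.2 hcon)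
  exact LinearMap.ker_eq_bot_iff_range_eq_top.1 hker

/-- A continuously differentiable map cannot retract a ball onto its boundary sphere. -/
theorem no_contDiff_retraction {E : Type*} [NormedAddCommGroup E] [InnerProductSpace ℝ E]
    [FiniteDimensional ℝ E] (r : E → E) (hr : ContDiff ℝ 1 r) (R : ℝ) (hR : 0 < R)
    (hnorm : ∀ x, ‖r x‖ = R) (hid : ∀ x, ‖x‖ = R → r x = x) : False := by
  borelize E
  let b : E → E := fun x => r x - x
  have hb : ContDiff ℝ 1 b := hr.sub contDiff_id
  have hbd : ∀ x, HasFDerivAt b (fderiv ℝ b x) x := fun x =>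
    (hb.differentiable one_ne_zero x).hasFDerivAt
  have hbc : Continuous (fderiv ℝ b) := hb.continuous_fderiv one_ne_zero
  let K : Set E := closedBall 0 R
  have hK : IsCompact K := isCompact_closedBall 0 R
  -- Lipschitz bound of the displacement on the ball
  obtain ⟨L, hL⟩ : ∃ L : ℝ, ∀ x ∈ K, ‖fderiv ℝ b x‖ ≤ L := by
    obtain ⟨L, hL⟩ := (hK.image hbc.norm).bddAbove
    exact ⟨L, fun x hx => hL ⟨x, hx, rfl⟩⟩
  have hLip : ∀ x ∈ K, ∀ y ∈ K, ‖b x - b y‖ ≤ L * ‖x - y‖ := fun x hx y hy =>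
    (convex_closedBall (0 : E) R).norm_image_sub_le_of_norm_fderiv_le
      (fun z _ => hb.differentiable one_ne_zero z) hL hy hx
  -- positivity of the Jacobian for small times
  have hdet : ∀ᶠ t in 𝓝 (0 : ℝ), ∀ x ∈ K, 0 < (1 + t • fderiv ℝ b x : E →L[ℝ] E).det := by
    refine hK.eventually_forall_of_forall_eventually fun x _ => ?_
    have hc : Continuous fun z : ℝ × E => (1 + z.1 • fderiv ℝ b z.2 : E →L[ℝ] E).det :=
      ContinuousLinearMap.continuous_det.comp
        (continuous_const.add (continuous_fst.smul (hbc.comp continuous_snd)))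
    refine hc.continuousAt.eventually_mem (isOpen_Ioi.mem_nhds ?_)
    simp [ContinuousLinearMap.det]
  obtain ⟨η₀, hη₀, hdet'⟩ := Metric.eventually_nhds_iff.1 hdet
  let η : ℝ := min η₀ (min 1 (1 / (|L| + 1)))
  have hη : 0 < η := by positivity
  -- for small times the homotopy preserves the volume of the ball
  have hvol : ∀ t, 0 < t → t < η →
      ∫ x in ball (0 : E) R, (1 + t • fderiv ℝ b x : E →L[ℝ] E).det = volume.real (ball (0 : E) R) := by
    intro t ht0 ht
    have ht1 : t < 1 := ht.trans_le ((min_le_right _ _).trans (min_le_left _ _))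
    have htL : t * L < 1 := by
      have h1 : t < 1 / (|L| + 1) := ht.trans_le ((min_le_right _ _).trans (min_le_right _ _))
      rw [lt_div_iff₀ (by positivity)] at h1
      nlinarith [le_abs_self L]
    have hpos : ∀ x ∈ K, 0 < (1 + t • fderiv ℝ b x : E →L[ℝ] E).det :=
      hdet' (by rw [Real.dist_eq, sub_zero, abs_of_pos ht0]; exact ht.trans_le (min_le_left _ _))
    let g : E → E := fun x => x + t • b x
    have hgd : ∀ x, HasStrictFDerivAt g (1 + t • fderiv ℝ b x : E →L[ℝ] E) x := fun x =>
      (hasStrictFDerivAt_id x).add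
        ((hb.contDiffAt.hasStrictFDerivAt one_ne_zero).const_smul t)
    have hgc : Continuous g := continuous_id.add (continuous_const.smul hb.continuous)
    have hinj : InjOn g K := by
      intro x hx y hy hxy
      by_contra hne
      have h1 : x - y = -(t • (b x - b y)) := by
        have : x + t • b x = y + t • b y := hxy
        rw [smul_sub, neg_sub, sub_eq_sub_iff_add_eq_add, this]; abel
      have h2 : ‖x - y‖ ≤ t * (L * ‖x - y‖) := by
        conv_lhs => rw [h1, norm_neg, norm_smul, Real.norm_of_nonneg ht0.le]
        exact mul_le_mul_of_nonneg_left (hLip x hx y hy) ht0.le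
      have h3 : 0 < ‖x - y‖ := norm_pos_iff.2 (sub_ne_zero.2 hne)
      nlinarith
    have hmaps : ∀ x ∈ ball (0 : E) R, g x ∈ ball (0 : E) R := by
      intro x hx
      rw [mem_ball_zero_iff] at hx ⊢
      have h1 : g x = (1 - t) • x + t • r x := by
        simp only [g, b, smul_sub, sub_smul, one_smul]; abel
      calc ‖g x‖ ≤ (1 - t) * ‖x‖ + t * R := by
            rw [h1]
            refine (norm_add_le _ _).trans_eq ?_
            rw [norm_smul, norm_smul, hnorm, Real.norm_of_nonneg ht0.le,
              Real.norm_of_nonneg (by linarith)]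
        _ < R := by nlinarith
    have hopen : IsOpen (g '' ball (0 : E) R) := by
      rw [isOpen_iff_mem_nhds]
      rintro _ ⟨x, hx, rfl⟩
      have hsurj : (1 + t • fderiv ℝ b x : E →L[ℝ] E).range = ⊤ :=
        range_eq_top_of_det_ne_zero _ (hpos x (ball_subset_closedBall hx)).ne'
      rw [← (hgd x).map_nhds_eq_of_surj hsurj]
      exact image_mem_map (isOpen_ball.mem_nhds hx)
    have himg : g '' ball (0 : E) R = ball (0 : E) R := by
      refine Subset.antisymm (by rintro _ ⟨x, hx, rfl⟩; exact hmaps x hx) ?_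
      have hcl : IsOpen (g '' K)ᶜ := (hK.image hgc).isClosed.isOpen_compl
      have hcover : ball (0 : E) R ⊆ g '' ball (0 : E) R ∪ (g '' K)ᶜ := by
        intro y hy
        by_contra hcon
        simp only [mem_union, not_or, mem_compl_iff, not_not] at hcon
        obtain ⟨h1, x, hx, rfl⟩ := hcon
        rcases (mem_closedBall_zero_iff.1 hx).lt_or_eq with h | h
        · exact h1 ⟨x, mem_ball_zero_iff.2 h, rfl⟩
        · have : g x = x := by simp [g, b, hid x h]
          rw [this, mem_ball_zero_iff, h] at hy
          exact lt_irrefl _ hy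
      refine (convex_ball (0 : E) R).isPreconnected.subset_left_of_subset_union hopen hcl ?_ hcover ?_
      · exact disjoint_compl_right_iff_subset.2 (image_mono ball_subset_closedBall)
      · exact ⟨g 0, hmaps 0 (mem_ball_self hR), 0, mem_ball_self hR, rfl⟩
    have hcv := integral_image_eq_integral_abs_det_fderiv_smul (volume : Measure E)
      (measurableSet_ball : MeasurableSet (ball (0 : E) R))
      (fun x _ => (hgd x).hasFDerivAt.hasFDerivWithinAt)
      (hinj.mono ball_subset_closedBall) (fun _ => (1 : ℝ))
    rw [himg] at hcv
    simp only [integral_const, smul_eq_mul, mul_one, measureReal_restrict_apply_univ] at hcv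
    rw [hcv]
    refine setIntegral_congr_fun measurableSet_ball fun x hx => ?_
    exact (abs_of_pos (hpos x (ball_subset_closedBall hx))).symm
  obtain ⟨s, v, w, hv, hw, hext⟩ := exists_extrapolation_det (E := E) η hη
  have hdr : ∀ x, (1 + fderiv ℝ b x : E →L[ℝ] E).det = 0 := by
    intro x
    have h1 : (1 + fderiv ℝ b x : E →L[ℝ] E) = fderiv ℝ r x := by
      have : r = fun y => y + b y := by ext y; simp [b]
      conv_rhs => rw [this]
      exact (((hasFDerivAt_id x).add (hbd x)).fderiv).symm
    have h2 : ∀ u, inner ℝ (r x) (fderiv ℝ r x u) = 0 := by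
      intro u
      have hd := (hr.differentiable one_ne_zero x).hasFDerivAt
      have h3 := hd.inner ℝ hd
      have h4 : (fun y => inner ℝ (r y) (r y)) = fun _ => R ^ 2 := by
        ext y; rw [real_inner_self_eq_norm_sq, hnorm]
      rw [h4] at h3
      have h5 := congrArg (fun T => T u) (h3.unique (hasFDerivAt_const (R ^ 2) x))
      simp [fderivInnerCLM_apply, real_inner_comm] at h5
      exact h5
    by_contra hne
    rw [h1] at hne
    have hsurj := range_eq_top_of_det_ne_zero _ hne
    obtain ⟨u, hu⟩ := LinearMap.range_eq_top.1 hsurj (r x)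
    have h6 := h2 u
    have hu' : fderiv ℝ r x u = r x := hu
    rw [hu', real_inner_self_eq_norm_sq, hnorm] at h6
    exact (pow_pos hR 2).ne' h6
  have hInt : ∀ j ∈ s, IntegrableOn
      (fun x => w j * (1 + v j • fderiv ℝ b x : E →L[ℝ] E).det) (ball (0 : E) R) := by
    intro j _
    have hc : Continuous fun x : E => w j * (1 + v j • fderiv ℝ b x : E →L[ℝ] E).det :=
      continuous_const.mul (ContinuousLinearMap.continuous_det.comp
        (continuous_const.add (hbc.const_smul (v j))))
    exact (hc.continuousOn.integrableOn_compact hK).mono_set ball_subset_closedBall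
  have h1 : ∫ x in ball (0 : E) R, (1 + fderiv ℝ b x : E →L[ℝ] E).det =
      volume.real (ball (0 : E) R) := by
    rw [show (fun x => (1 + fderiv ℝ b x : E →L[ℝ] E).det) = fun x => ∑ j ∈ s,
      w j * (1 + v j • fderiv ℝ b x : E →L[ℝ] E).det from funext fun x => hext _]
    rw [integral_finsetSum _ hInt]
    simp_rw [integral_const_mul]
    rw [Finset.sum_congr rfl fun j hj => by rw [hvol (v j) (hv j hj).1 (hv j hj).2],
      ← Finset.sum_mul, hw, one_mul]
  simp only [hdr, integral_zero] at h1
  have h2 : 0 < volume.real (ball (0 : E) R) := by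
    rw [measureReal_def, ENNReal.toReal_pos_iff]
    exact ⟨measure_ball_pos _ _ hR, measure_ball_lt_top⟩
  exact h2.ne h1

/-- **Brouwer fixed point theorem** for bounded maps of a finite-dimensional inner product space. -/
theorem exists_fixedPoint_of_bounded_inner {E : Type*} [NormedAddCommGroup E]
    [InnerProductSpace ℝ E] [FiniteDimensional ℝ E] (f : E → E) (hf : Continuous f) (C : ℝ)
    (hC : ∀ x, ‖f x‖ ≤ C) : ∃ x, f x = x := by
  by_contra! hne
  have hC0 : 0 ≤ C := (norm_nonneg _).trans (hC 0)
  obtain ⟨g, hg, hgf, -⟩ := hf.exists_contDiff_approx 1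
    (ε := fun x => min 1 (dist (f x) x)) (continuous_const.min (hf.dist continuous_id))
    (fun x => lt_min one_pos (dist_pos.2 (hne x)))
  have hgC : ∀ x, ‖g x‖ ≤ C + 1 := by
    intro x
    have h1 := (hgf x).trans_le (min_le_left _ _)
    rw [dist_eq_norm] at h1
    linarith [norm_le_norm_add_norm_sub' (g x) (f x), hC x]
  have hgne : ∀ x, g x ≠ x := by
    intro x hx
    have h1 := (hgf x).trans_le (min_le_right _ _)
    rw [hx, dist_comm] at h1
    exact lt_irrefl _ h1
  let χ : ContDiffBump (0 : E) := ⟨C + 1, C + 2, by linarith, by linarith⟩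
  let h : E → E := fun x => x - χ x • g x
  have hh : ContDiff ℝ 1 h := contDiff_id.sub (χ.contDiff.smul hg)
  have hh0 : ∀ x, h x ≠ 0 := by
    intro x hx
    have hx' : x = χ x • g x := sub_eq_zero.1 hx
    by_cases hxC : ‖x‖ ≤ C + 1
    · rw [χ.one_of_mem_closedBall (mem_closedBall_zero_iff.2 hxC), one_smul] at hx'
      exact hgne x hx'.symm
    · apply hxC
      rw [hx', norm_smul, Real.norm_of_nonneg χ.nonneg]
      calc χ x * ‖g x‖ ≤ 1 * ‖g x‖ := mul_le_mul_of_nonneg_right χ.le_one (norm_nonneg _)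
        _ ≤ C + 1 := by rw [one_mul]; exact hgC x
  refine no_contDiff_retraction (fun x => ((C + 2) * ‖h x‖⁻¹) • h x) ?_ (C + 2) (by linarith) ?_ ?_
  · exact (contDiff_const.mul ((hh.norm ℝ hh0).inv fun x => norm_ne_zero_iff.2 (hh0 x))).smul hh
  · intro x
    have := norm_pos_iff.2 (hh0 x)
    rw [norm_smul, Real.norm_of_nonneg (by positivity)]
    field_simp
  · intro x hx
    have h1 : h x = x := by
      simp only [h]
      rw [χ.zero_of_le_dist (by rw [dist_zero_right, hx]), zero_smul, sub_zero]
    simp only [h1, hx]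
    rw [mul_inv_cancel₀ (by linarith), one_smul]

/-- **Brouwer fixed point theorem** for bounded maps of a finite-dimensional normed space. -/
theorem exists_fixedPoint_of_bounded {E : Type*} [NormedAddCommGroup E]
    [NormedSpace ℝ E] [FiniteDimensional ℝ E] (f : E → E) (hf : Continuous f) (C : ℝ)
    (hC : ∀ x, ‖f x‖ ≤ C) : ∃ x, f x = x := by
  let e : E ≃L[ℝ] EuclideanSpace ℝ (Fin (Module.finrank ℝ E)) :=
    ContinuousLinearEquiv.ofFinrankEq (by simp)
  let T : E →L[ℝ] EuclideanSpace ℝ (Fin (Module.finrank ℝ E)) := e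
  obtain ⟨x, hx⟩ := exists_fixedPoint_of_bounded_inner (fun x => e (f (e.symm x)))
    (e.continuous.comp (hf.comp e.symm.continuous)) (‖T‖ * C) fun x =>
      (T.le_opNorm _).trans (mul_le_mul_of_nonneg_left (hC _) (norm_nonneg _))
  refine ⟨e.symm x, e.injective ?_⟩
  rw [hx, e.apply_symm_apply]

/-- The circle character `t ↦ exp (2πikt)`. -/
noncomputable def circleChar (k : ℤ) (t : ℝ) : ℂ := Complex.exp (2 * Real.pi * k * t * Complex.I)

theorem continuous_circleChar (k : ℤ) : Continuous (circleChar k) := by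
  unfold circleChar; fun_prop

theorem norm_circleChar (k : ℤ) (t : ℝ) : ‖circleChar k t‖ = 1 := by
  have := Complex.norm_exp_ofReal_mul_I (2 * Real.pi * k * t)
  push_cast at this
  exact this

theorem conj_circleChar (k : ℤ) (t : ℝ) :
    (starRingEnd ℂ) (circleChar k t) = circleChar (-k) t := by
  have h2 : (starRingEnd ℂ) (2 : ℂ) = 2 := Complex.conj_ofNat 2
  simp [circleChar, ← Complex.exp_conj, h2]

theorem circleChar_mul (k l : ℤ) (t : ℝ) :
    circleChar k t * circleChar l t = circleChar (k + l) t := by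
  rw [circleChar, circleChar, circleChar, ← Complex.exp_add]
  push_cast
  ring_nf

theorem circleChar_zero (t : ℝ) : circleChar 0 t = 1 := by simp [circleChar]

theorem circleChar_at_zero (k : ℤ) : circleChar k 0 = 1 := by simp [circleChar]

theorem circleChar_at_one (k : ℤ) : circleChar k 1 = 1 := by
  have := Complex.exp_int_mul_two_pi_mul_I k
  rw [← this, circleChar]
  congr 1
  push_cast
  ring

theorem hasDerivAt_circleChar (k : ℤ) (t : ℝ) :
    HasDerivAt (circleChar k) ((2 * Real.pi * k * Complex.I) * circleChar k t) t := by
  have h1 : HasDerivAt (fun t : ℝ => (2 * Real.pi * k * (t : ℂ) * Complex.I))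
      (2 * Real.pi * k * Complex.I) t := by
    have := ((Complex.ofRealCLM.hasDerivAt (x := t)).const_mul
      (2 * Real.pi * k : ℂ)).mul_const Complex.I
    simp only [Complex.ofRealCLM_apply, Complex.ofReal_one, mul_one] at this
    exact this
  have := h1.cexp
  rw [mul_comm (Complex.exp _)] at this
  exact this

theorem integral_circleChar (k : ℤ) :
    ∫ t in (0:ℝ)..1, circleChar k t = if k = 0 then 1 else 0 := by
  split_ifs with h
  · subst h
    simp [circleChar_zero]
  · have hk : (2 * Real.pi * k * Complex.I : ℂ) ≠ 0 := by
      simp [Real.pi_ne_zero, h]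
    have h1 := intervalIntegral.integral_eq_sub_of_hasDerivAt
      (f := circleChar k) (a := 0) (b := 1) (fun t _ => hasDerivAt_circleChar k t)
      ((continuous_const.mul (continuous_circleChar k)).intervalIntegrable _ _)
    rw [intervalIntegral.integral_const_mul, circleChar_at_zero, circleChar_at_one, sub_self] at h1
    exact (mul_eq_zero.1 h1).resolve_left hk

section Fourier

variable {W : Type*} [NormedAddCommGroup W] [InnerProductSpace ℂ W]

/-- The trigonometric polynomial with coefficients `a k`, `k ∈ S`. -/
noncomputable def trigPoly (S : Finset ℤ) (a : ℤ → W) (t : ℝ) : W :=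
  ∑ k ∈ S, circleChar k t • a k

/-- The `k`-th Fourier coefficient of a curve on `[0, 1]`. -/
noncomputable def curveCoeff (v : ℝ → W) (k : ℤ) : W :=
  ∫ t in (0:ℝ)..1, circleChar (-k) t • v t

theorem continuous_trigPoly (S : Finset ℤ) (a : ℤ → W) : Continuous (trigPoly S a) := by
  unfold trigPoly
  exact continuous_finsetSum _ fun k _ => (continuous_circleChar k).smul continuous_const

theorem continuous_trigPoly_uncurry (S : Finset ℤ) :
    Continuous fun p : (ℤ → W) × ℝ => trigPoly S p.1 p.2 := by
  unfold trigPoly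
  exact continuous_finsetSum _ fun k _ => ((continuous_circleChar k).comp continuous_snd).smul
    ((continuous_apply k).comp continuous_fst)

theorem trigPoly_add (S : Finset ℤ) (a b : ℤ → W) (t : ℝ) :
    trigPoly S (a + b) t = trigPoly S a t + trigPoly S b t := by
  simp [trigPoly, Finset.sum_add_distrib]

theorem norm_curveCoeff_le (v : ℝ → W) (k : ℤ) (C : ℝ) (h : ∀ t, ‖v t‖ ≤ C) :
    ‖curveCoeff v k‖ ≤ C := by
  have := intervalIntegral.norm_integral_le_of_norm_le_const (a := 0) (b := 1) (C := C)
    (f := fun t => circleChar (-k) t • v t) (fun t _ => by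
      rw [norm_smul, norm_circleChar, one_mul]; exact h t)
  simpa [curveCoeff] using this

theorem integral_re_inner (u v : ℝ → W) (hu : Continuous u) (hv : Continuous v) :
    ∫ t in (0:ℝ)..1, (inner ℂ (u t) (v t)).re = (∫ t in (0:ℝ)..1, inner ℂ (u t) (v t)).re :=
  Complex.reCLM.intervalIntegral_comp_comm ((hu.inner hv).intervalIntegrable _ _)

variable [CompleteSpace W]

theorem curveCoeff_trigPoly (S : Finset ℤ) (a : ℤ → W) (k : ℤ) :
    curveCoeff (trigPoly S a) k = if k ∈ S then a k else 0 := by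
  unfold curveCoeff trigPoly
  have h1 : ∀ t : ℝ, circleChar (-k) t • ∑ l ∈ S, circleChar l t • a l =
      ∑ l ∈ S, circleChar (-k + l) t • a l := fun t => by
    rw [Finset.smul_sum]
    exact Finset.sum_congr rfl fun l _ => by rw [smul_smul, circleChar_mul]
  simp_rw [h1]
  rw [intervalIntegral.integral_finsetSum (f := fun l t => circleChar (-k + l) t • a l) fun l _ =>
    ((continuous_circleChar _).smul continuous_const).intervalIntegrable _ _]
  have h2 : ∀ l, ∫ t in (0:ℝ)..1, circleChar (-k + l) t • a l = if k = l then a l else 0 := fun l => by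
    rw [intervalIntegral.integral_smul_const, integral_circleChar]
    by_cases h : k = l
    · simp [h]
    · rw [if_neg h, if_neg, zero_smul]
      intro h'
      exact h (by omega)
  simp_rw [h2]
  exact Finset.sum_ite_eq S k a

theorem inner_curveCoeff (v : ℝ → W) (hv : Continuous v) (k : ℤ) (b : W) :
    inner ℂ b (curveCoeff v k) = ∫ t in (0:ℝ)..1, inner ℂ (circleChar k t • b) (v t) := by
  have h1 := (innerSL ℂ b).intervalIntegral_comp_comm (μ := volume) (a := 0) (b := 1)
    (f := fun t => circleChar (-k) t • v t)
    (((continuous_circleChar (-k)).smul hv).intervalIntegrable _ _)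
  rw [innerSL_apply_apply] at h1
  rw [curveCoeff, ← h1]
  refine intervalIntegral.integral_congr fun t _ => ?_
  simp only [innerSL_apply_apply]
  rw [inner_smul_left, inner_smul_right, conj_circleChar]

theorem sum_inner_curveCoeff (S : Finset ℤ) (v : ℝ → W) (hv : Continuous v) (b : ℤ → W) :
    ∑ k ∈ S, inner ℂ (b k) (curveCoeff v k) =
      ∫ t in (0:ℝ)..1, inner ℂ (trigPoly S b t) (v t) := by
  simp_rw [inner_curveCoeff v hv, trigPoly, sum_inner]
  rw [intervalIntegral.integral_finsetSum fun k _ => ?_]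
  exact (((continuous_circleChar k).smul continuous_const).inner hv).intervalIntegrable _ _

theorem sum_re_inner_curveCoeff (S : Finset ℤ) (v : ℝ → W) (hv : Continuous v) (b : ℤ → W) :
    ∑ k ∈ S, (inner ℂ (curveCoeff v k) (b k)).re =
      ∫ t in (0:ℝ)..1, (inner ℂ (v t) (trigPoly S b t)).re := by
  have h (x y : W) : (inner ℂ x y).re = (inner ℂ y x).re := inner_re_symm (𝕜 := ℂ) x y
  simp_rw [h _ (b _), h _ (trigPoly _ _ _)]
  rw [integral_re_inner _ _ (continuous_trigPoly S b) hv, ← sum_inner_curveCoeff S v hv,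
    Complex.re_sum]

theorem integral_norm_sq_trigPoly (S : Finset ℤ) (a : ℤ → W) :
    ∫ t in (0:ℝ)..1, ‖trigPoly S a t‖ ^ 2 = ∑ k ∈ S, ‖a k‖ ^ 2 := by
  have h (x : W) : ‖x‖ ^ 2 = (inner ℂ x x).re := (inner_self_eq_norm_sq (𝕜 := ℂ) x).symm
  simp_rw [h]
  rw [← sum_re_inner_curveCoeff S _ (continuous_trigPoly S a)]
  refine Finset.sum_congr rfl fun k hk => ?_
  rw [curveCoeff_trigPoly, if_pos hk]

theorem sum_norm_sq_curveCoeff_le (S : Finset ℤ) (v : ℝ → W) (hv : Continuous v) :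
    ∑ k ∈ S, ‖curveCoeff v k‖ ^ 2 ≤ ∫ t in (0:ℝ)..1, ‖v t‖ ^ 2 := by
  let P := trigPoly S (curveCoeff v)
  have hP : Continuous P := continuous_trigPoly _ _
  have h1 : ∀ t, (0:ℝ) ≤ ‖v t‖ ^ 2 - 2 * (inner ℂ (v t) (P t)).re + ‖P t‖ ^ 2 := fun t => by
    have := norm_sub_sq (𝕜 := ℂ) (v t) (P t)
    rw [show (RCLike.re (inner ℂ (v t) (P t)) : ℝ) = (inner ℂ (v t) (P t)).re from rfl] at this
    rw [← this]; positivity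
  have h2 : (0:ℝ) ≤ ∫ t in (0:ℝ)..1, (‖v t‖ ^ 2 - 2 * (inner ℂ (v t) (P t)).re + ‖P t‖ ^ 2) :=
    intervalIntegral.integral_nonneg zero_le_one fun t _ => h1 t
  have c1 : Continuous fun t => (inner ℂ (v t) (P t)).re := Complex.continuous_re.comp (hv.inner hP)
  rw [intervalIntegral.integral_add, intervalIntegral.integral_sub,
    intervalIntegral.integral_const_mul, ← sum_re_inner_curveCoeff S v hv,
    integral_norm_sq_trigPoly] at h2
  · have h3 : ∀ k, (inner ℂ (curveCoeff v k) (curveCoeff v k)).re = ‖curveCoeff v k‖ ^ 2 :=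
      fun k => inner_self_eq_norm_sq (𝕜 := ℂ) _
    simp_rw [h3] at h2
    linarith
  all_goals exact Continuous.intervalIntegrable (by fun_prop) _ _

end Fourier

section Action

variable {W : Type*} [NormedAddCommGroup W] [InnerProductSpace ℂ W]

/-- A time-dependent function `h` with bounded gradient `g` and a uniform quadratic Taylor bound. -/
structure TamedHam (h : ℝ → W → ℝ) (g : ℝ → W → W) (C l : ℝ) : Prop where
  continuous_fun : Continuous fun p : ℝ × W => h p.1 p.2
  continuous_grad : Continuous fun p : ℝ × W => g p.1 p.2
  norm_grad_le : ∀ t x, ‖g t x‖ ≤ C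
  taylor : ∀ t x u, |h t (x + u) - h t x - (inner ℂ (g t x) u).re| ≤ l * ‖u‖ ^ 2

/-- The action functional on trigonometric polynomials. -/
noncomputable def action (S : Finset ℤ) (h : ℝ → W → ℝ) (a : ℤ → W) : ℝ :=
  ∑ k ∈ S, Real.pi * k * ‖a k‖ ^ 2 - ∫ t in (0:ℝ)..1, h t (trigPoly S a t)

/-- The gradient of the action functional. -/
noncomputable def actionGrad (S : Finset ℤ) (g : ℝ → W → W) (a : ℤ → W) (k : ℤ) : W :=
  (2 * Real.pi * k : ℝ) • a k - curveCoeff (fun t => g t (trigPoly S a t)) k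

theorem TamedHam.continuous_comp {h : ℝ → W → ℝ} {g : ℝ → W → W} {C l : ℝ}
    (H : TamedHam h g C l) {z : ℝ → W} (hz : Continuous z) : Continuous fun t => h t (z t) :=
  H.continuous_fun.comp (continuous_id.prodMk hz)

theorem TamedHam.continuous_grad_comp {h : ℝ → W → ℝ} {g : ℝ → W → W} {C l : ℝ}
    (H : TamedHam h g C l) {z : ℝ → W} (hz : Continuous z) : Continuous fun t => g t (z t) :=
  H.continuous_grad.comp (continuous_id.prodMk hz)

theorem TamedHam.sub_smul {h₀ h₁ : ℝ → W → ℝ} {g₀ g₁ : ℝ → W → W} {C₀ l₀ C₁ l₁ : ℝ}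
    (H₀ : TamedHam h₀ g₀ C₀ l₀) (H₁ : TamedHam h₁ g₁ C₁ l₁) {s : ℝ} (hs : s ∈ Icc (0:ℝ) 1) :
    TamedHam (fun t x => h₀ t x - s * h₁ t x) (fun t x => g₀ t x - s • g₁ t x)
      (C₀ + C₁) (l₀ + l₁) where
  continuous_fun := H₀.continuous_fun.sub (continuous_const.mul H₁.continuous_fun)
  continuous_grad := H₀.continuous_grad.sub (H₁.continuous_grad.const_smul s)
  norm_grad_le t x := by
    refine (norm_sub_le _ _).trans (add_le_add (H₀.norm_grad_le t x) ?_)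
    rw [norm_smul, Real.norm_of_nonneg hs.1]
    have := H₁.norm_grad_le t x
    nlinarith [norm_nonneg (g₁ t x), hs.1, hs.2]
  taylor t x u := by
    have e1 : (inner ℂ (g₀ t x - s • g₁ t x) u).re =
        (inner ℂ (g₀ t x) u).re - s * (inner ℂ (g₁ t x) u).re := by
      rw [inner_sub_left, RCLike.real_smul_eq_coe_smul (K := ℂ) s, inner_smul_left]
      simp
    have h1 := abs_le.1 (H₀.taylor t x u)
    have h2 := abs_le.1 (H₁.taylor t x u)
    have h3 := mul_le_mul_of_nonneg_left h2.1 hs.1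
    have h4 := mul_le_mul_of_nonneg_left h2.2 hs.1
    have h5 : 0 ≤ l₁ * ‖u‖ ^ 2 := (abs_nonneg _).trans (H₁.taylor t x u)
    have h6 : s * (l₁ * ‖u‖ ^ 2) ≤ l₁ * ‖u‖ ^ 2 := mul_le_of_le_one_left h5 hs.2
    rw [e1, abs_le]
    constructor <;> nlinarith

variable [CompleteSpace W]

theorem action_descent {h : ℝ → W → ℝ} {g : ℝ → W → W} {C l : ℝ} (H : TamedHam h g C l)
    (N : ℕ) (a : ℤ → W) (τ : ℝ) (hτ : 0 ≤ τ) (hτl : τ * (Real.pi * N + l) ≤ 1 / 2) :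
    action (Finset.Icc (-N : ℤ) N) h
        (fun k => a k - τ • actionGrad (Finset.Icc (-N : ℤ) N) g a k) ≤
      action (Finset.Icc (-N : ℤ) N) h a -
        τ / 2 * ∑ k ∈ Finset.Icc (-N : ℤ) N, ‖actionGrad (Finset.Icc (-N : ℤ) N) g a k‖ ^ 2 := by
  set S := Finset.Icc (-N : ℤ) N with hS
  set D := actionGrad S g a with hD
  let u : ℤ → W := fun k => -(τ • D k)
  have hau : (fun k => a k - τ • D k) = a + u := by
    ext k; simp [u, sub_eq_add_neg]
  rw [hau]
  have cz : Continuous (trigPoly S a) := continuous_trigPoly S a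
  have cu : Continuous (trigPoly S u) := continuous_trigPoly S u
  have cg := H.continuous_grad_comp cz
  have ci : Continuous fun t => (inner ℂ (g t (trigPoly S a t)) (trigPoly S u t)).re :=
    Complex.continuous_re.comp (cg.inner cu)
  have hInt : (∫ t in (0:ℝ)..1, h t (trigPoly S a t)) +
      ∑ k ∈ S, (inner ℂ (curveCoeff (fun t => g t (trigPoly S a t)) k) (u k)).re -
      l * ∑ k ∈ S, ‖u k‖ ^ 2 ≤ ∫ t in (0:ℝ)..1, h t (trigPoly S (a + u) t) := by
    rw [sum_re_inner_curveCoeff S _ cg u, ← integral_norm_sq_trigPoly,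
      ← intervalIntegral.integral_const_mul, ← intervalIntegral.integral_add,
      ← intervalIntegral.integral_sub]
    · refine intervalIntegral.integral_mono_on zero_le_one ?_ ?_ fun t _ => ?_
      · exact Continuous.intervalIntegrable
          (((H.continuous_comp cz).add ci).sub (continuous_const.mul (cu.norm.pow 2))) _ _
      · exact (H.continuous_comp (continuous_trigPoly S (a + u))).intervalIntegrable _ _
      · have := (abs_le.1 (H.taylor t (trigPoly S a t) (trigPoly S u t))).1
        rw [trigPoly_add]
        linarith
    · exact ((H.continuous_comp cz).add ci).intervalIntegrable _ _
    · exact (continuous_const.mul (cu.norm.pow 2)).intervalIntegrable _ _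
    · exact (H.continuous_comp cz).intervalIntegrable _ _
    · exact ci.intervalIntegrable _ _
  have hk : ∀ k ∈ S, Real.pi * k * ‖(a + u) k‖ ^ 2 ≤ Real.pi * k * ‖a k‖ ^ 2 +
      2 * Real.pi * k * (inner ℂ (a k) (u k)).re + Real.pi * N * ‖u k‖ ^ 2 := by
    intro k hk
    have e : ‖(a + u) k‖ ^ 2 = ‖a k‖ ^ 2 + 2 * (inner ℂ (a k) (u k)).re + ‖u k‖ ^ 2 :=
      norm_add_sq (𝕜 := ℂ) (a k) (u k)
    have hkN : (k : ℝ) ≤ N := by exact_mod_cast (Finset.mem_Icc.1 hk).2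
    have : Real.pi * k * ‖u k‖ ^ 2 ≤ Real.pi * N * ‖u k‖ ^ 2 := by gcongr
    rw [e]
    linarith
  have hDk : ∀ k, 2 * Real.pi * k * (inner ℂ (a k) (u k)).re -
      (inner ℂ (curveCoeff (fun t => g t (trigPoly S a t)) k) (u k)).re = -τ * ‖D k‖ ^ 2 := by
    intro k
    have e1 : (inner ℂ (D k) (u k)).re = 2 * Real.pi * k * (inner ℂ (a k) (u k)).re -
        (inner ℂ (curveCoeff (fun t => g t (trigPoly S a t)) k) (u k)).re := by
      rw [hD, actionGrad, inner_sub_left, RCLike.real_smul_eq_coe_smul (K := ℂ), inner_smul_left]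
      simp
    have e2 : (inner ℂ (D k) (D k)).re = ‖D k‖ ^ 2 := inner_self_eq_norm_sq (𝕜 := ℂ) _
    rw [← e1, ← e2]
    simp only [u]
    rw [inner_neg_right, RCLike.real_smul_eq_coe_smul (K := ℂ), inner_smul_right]
    simp
  have hu : ∀ k, ‖u k‖ ^ 2 = τ ^ 2 * ‖D k‖ ^ 2 := by
    intro k
    simp only [u]
    rw [norm_neg, norm_smul, Real.norm_of_nonneg hτ, mul_pow]
  have hsum := Finset.sum_le_sum hk
  have hsD : ∑ k ∈ S, 2 * Real.pi * k * (inner ℂ (a k) (u k)).re -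
      ∑ k ∈ S, (inner ℂ (curveCoeff (fun t => g t (trigPoly S a t)) k) (u k)).re =
      -τ * ∑ k ∈ S, ‖D k‖ ^ 2 := by
    rw [← Finset.sum_sub_distrib, Finset.sum_congr rfl fun k _ => hDk k, Finset.mul_sum]
  have hsu : ∑ k ∈ S, ‖u k‖ ^ 2 = τ ^ 2 * ∑ k ∈ S, ‖D k‖ ^ 2 := by
    rw [Finset.sum_congr rfl fun k _ => hu k, Finset.mul_sum]
  rw [Finset.sum_add_distrib, Finset.sum_add_distrib, ← Finset.mul_sum (a := Real.pi * (N : ℝ)),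
    hsu] at hsum
  rw [hsu] at hInt
  have hnn : 0 ≤ ∑ k ∈ S, ‖D k‖ ^ 2 := Finset.sum_nonneg fun k _ => by positivity
  have hfin : τ * (τ * (Real.pi * N + l)) * ∑ k ∈ S, ‖D k‖ ^ 2 ≤
      τ * (1 / 2) * ∑ k ∈ S, ‖D k‖ ^ 2 := by gcongr
  unfold action
  linarith

end Action

section Descent

variable {W : Type*} [NormedAddCommGroup W] [InnerProductSpace ℂ W]

/-- Explicit Euler steps of size `τ` for the negative gradients of a sequence of actions. -/
noncomputable def descentSeq (S : Finset ℤ) (G : ℕ → ℝ → W → W) (τ : ℝ) :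
    ℕ → (ℤ → W) → ℤ → W
  | 0, y => y
  | j + 1, y => fun k => descentSeq S G τ j y k - τ • actionGrad S (G j) (descentSeq S G τ j y) k

theorem continuous_actionGrad (S : Finset ℤ) (g : ℝ → W → W)
    (hg : Continuous fun p : ℝ × W => g p.1 p.2) : Continuous (actionGrad S g) := by
  refine continuous_pi fun k => ((continuous_apply k).const_smul _).sub ?_
  unfold curveCoeff
  refine intervalIntegral.continuous_parametric_intervalIntegral_of_continuous' ?_ 0 1
  exact ((continuous_circleChar (-k)).comp continuous_snd).smul
    (hg.comp (continuous_snd.prodMk (continuous_trigPoly_uncurry S)))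

theorem continuous_descentSeq (S : Finset ℤ) (G : ℕ → ℝ → W → W) (τ : ℝ)
    (hG : ∀ j, Continuous fun p : ℝ × W => G j p.1 p.2) (j : ℕ) :
    Continuous (descentSeq S G τ j) := by
  induction j with
  | zero => exact continuous_id
  | succ j ih =>
    exact ih.sub (((continuous_actionGrad S (G j) (hG j)).comp ih).const_smul τ)

theorem exists_norm_descentSeq_sub_le (S : Finset ℤ) (G : ℕ → ℝ → W → W) (τ C : ℝ)
    (hG : ∀ j t x, ‖G j t x‖ ≤ C) (j : ℕ) (k : ℤ) :
    ∃ B, ∀ y, ‖descentSeq S G τ j y k - (1 - 2 * Real.pi * k * τ) ^ j • y k‖ ≤ B := by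
  induction j with
  | zero => exact ⟨0, fun y => by simp [descentSeq]⟩
  | succ j ih =>
    obtain ⟨B, hB⟩ := ih
    set μ := 1 - 2 * Real.pi * k * τ with hμ
    refine ⟨|μ| * B + |τ| * C, fun y => ?_⟩
    have e : descentSeq S G τ (j + 1) y k - μ ^ (j + 1) • y k =
        μ • (descentSeq S G τ j y k - μ ^ j • y k) +
          τ • curveCoeff (fun t => G j t (trigPoly S (descentSeq S G τ j y) t)) k := by
      simp only [descentSeq, actionGrad]
      rw [smul_sub, smul_sub, smul_smul, smul_smul, ← pow_succ', hμ, sub_smul, one_smul,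
        show 2 * Real.pi * k * τ = τ * (2 * Real.pi * k) by ring]
      abel
    rw [e]
    refine (norm_add_le _ _).trans (add_le_add ?_ ?_)
    · rw [norm_smul, Real.norm_eq_abs]
      exact mul_le_mul_of_nonneg_left (hB y) (abs_nonneg _)
    · rw [norm_smul, Real.norm_eq_abs]
      exact mul_le_mul_of_nonneg_left (norm_curveCoeff_le _ _ _ fun t => hG _ _ _) (abs_nonneg _)

/-- Some initial condition with only nonpositive frequencies flows, after `J` steps, to one with only
positive frequencies. -/
theorem exists_descentSeq_eq_zero [FiniteDimensional ℂ W] (N : ℕ) (G : ℕ → ℝ → W → W) (τ C : ℝ)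
    (hτ : 0 ≤ τ) (hG : ∀ j, Continuous fun p : ℝ × W => G j p.1 p.2)
    (hGC : ∀ j t x, ‖G j t x‖ ≤ C) (J : ℕ) :
    ∃ y : ℤ → W, (∀ k, 0 < k → y k = 0) ∧ ∀ k ∈ Finset.Icc (-N : ℤ) 0,
      descentSeq (Finset.Icc (-N : ℤ) N) G τ J y k = 0 := by
  classical
  have : FiniteDimensional ℝ W := FiniteDimensional.complexToReal W
  set S := Finset.Icc (-N : ℤ) N
  let I := {k : ℤ // k ∈ Finset.Icc (-N : ℤ) 0}
  let ext : (I → W) → ℤ → W := fun Y k => if h : k ∈ Finset.Icc (-N : ℤ) 0 then Y ⟨k, h⟩ else 0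
  have hext : Continuous ext := by
    refine continuous_pi fun k => ?_
    by_cases h : k ∈ Finset.Icc (-N : ℤ) 0
    · simp only [ext, dif_pos h]; exact continuous_apply _
    · simp only [ext, dif_neg h]; exact continuous_const
  let μ : ℤ → ℝ := fun k => 1 - 2 * Real.pi * k * τ
  have hμ : ∀ k : I, 1 ≤ μ k := by
    intro k
    have h1 : ((k : ℤ) : ℝ) ≤ 0 := by exact_mod_cast (Finset.mem_Icc.1 k.2).2
    have h2 : 0 ≤ Real.pi * τ := mul_nonneg Real.pi_pos.le hτ
    simp only [μ]
    nlinarith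
  choose B hB using exists_norm_descentSeq_sub_le S G τ C hGC J
  let F : (I → W) → I → W := fun Y k => Y k - (μ k ^ J)⁻¹ • descentSeq S G τ J (ext Y) k
  have hF : Continuous F := by
    refine continuous_pi fun k => (continuous_apply k).sub (Continuous.const_smul ?_ _)
    exact (continuous_apply (k : ℤ)).comp ((continuous_descentSeq S G τ hG J).comp hext)
  have hFB : ∀ Y, ‖F Y‖ ≤ ∑ k : I, |B k| := by
    intro Y
    rw [pi_norm_le_iff_of_nonneg (Finset.sum_nonneg fun k _ => abs_nonneg _)]
    intro k
    have h0 : 1 ≤ μ k ^ J := one_le_pow₀ (hμ k)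
    have hY : ext Y k = Y k := by simp only [ext, dif_pos k.2]; rfl
    have e : F Y k = -((μ k ^ J)⁻¹ •
        (descentSeq S G τ J (ext Y) k - μ k ^ J • ext Y k)) := by
      simp only [F]
      rw [smul_sub, smul_smul, inv_mul_cancel₀ (by positivity), one_smul, hY]
      abel
    rw [e, norm_neg, norm_smul, norm_inv, Real.norm_of_nonneg (by positivity)]
    calc (μ k ^ J)⁻¹ * ‖descentSeq S G τ J (ext Y) k - μ k ^ J • ext Y k‖
        ≤ 1 * |B k| := by
          refine mul_le_mul (inv_le_one_of_one_le₀ h0) ((hB k _).trans (le_abs_self _))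
            (norm_nonneg _) zero_le_one
      _ = |B k| := one_mul _
      _ ≤ _ := Finset.single_le_sum (f := fun k : I => |B k|) (fun _ _ => abs_nonneg _)
        (Finset.mem_univ k)
  obtain ⟨Y, hY⟩ := exists_fixedPoint_of_bounded F hF _ hFB
  refine ⟨ext Y, fun k hk => ?_, fun k hk => ?_⟩
  · simp only [ext]
    rw [dif_neg]
    intro h
    have := (Finset.mem_Icc.1 h).2
    omega
  · have h1 := congrFun hY ⟨k, hk⟩
    simp only [F] at h1
    have h2 := sub_eq_self.1 h1
    refine (smul_eq_zero.1 h2).resolve_left (inv_ne_zero (pow_ne_zero _ ?_))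
    have := hμ ⟨k, hk⟩
    positivity

theorem action_le_of_nonpos (S : Finset ℤ) (h : ℝ → W → ℝ) (y : ℤ → W) (ε : ℝ)
    (hh : Continuous fun p : ℝ × W => h p.1 p.2) (hε : ∀ t x, |h t x| ≤ ε)
    (hy : ∀ k, 0 < k → y k = 0) : action S h y ≤ ε := by
  have h1 : ∑ k ∈ S, Real.pi * k * ‖y k‖ ^ 2 ≤ 0 := by
    refine Finset.sum_nonpos fun k _ => ?_
    rcases lt_or_ge 0 k with hk | hk
    · simp [hy k hk]
    · have : (k : ℝ) ≤ 0 := by exact_mod_cast hk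
      exact mul_nonpos_of_nonpos_of_nonneg
        (mul_nonpos_of_nonneg_of_nonpos Real.pi_pos.le this) (by positivity)
  have h2 : ∫ t in (0:ℝ)..1, -ε ≤ ∫ t in (0:ℝ)..1, h t (trigPoly S y t) := by
    refine intervalIntegral.integral_mono_on zero_le_one
      (continuous_const.intervalIntegrable _ _) ?_ fun t _ => (abs_le.1 (hε t _)).1
    exact (hh.comp (continuous_id.prodMk (continuous_trigPoly S y))).intervalIntegrable _ _
  simp at h2
  unfold action
  linarith

variable [CompleteSpace W]

theorem le_action_of_pos (N : ℕ) (h₀ h₁ : ℝ → W → ℝ) (z : ℤ → W) (ε : ℝ) (w : ℝ → ℝ)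
    (hh₀ : Continuous fun p : ℝ × W => h₀ p.1 p.2) (hh₁ : Continuous fun p : ℝ × W => h₁ p.1 p.2)
    (hε : ∀ t x, |h₀ t x| ≤ ε) (hwc : Continuous w)
    (hw : ∀ t x, w t ≤ Real.pi * ‖x‖ ^ 2 + h₁ t x)
    (hz : ∀ k ∈ Finset.Icc (-N : ℤ) 0, z k = 0) :
    (∫ t in (0:ℝ)..1, w t) - ε ≤
      action (Finset.Icc (-N : ℤ) N) (fun t x => h₀ t x - 1 * h₁ t x) z := by
  set S := Finset.Icc (-N : ℤ) N
  have h1 : ∑ k ∈ S, Real.pi * ‖z k‖ ^ 2 ≤ ∑ k ∈ S, Real.pi * k * ‖z k‖ ^ 2 := by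
    refine Finset.sum_le_sum fun k hk => ?_
    rcases le_or_gt k 0 with h | h
    · simp [hz k (Finset.mem_Icc.2 ⟨(Finset.mem_Icc.1 hk).1, h⟩)]
    · have : (1 : ℝ) ≤ k := by exact_mod_cast h
      have hp := Real.pi_pos
      gcongr
      exact le_mul_of_one_le_right hp.le this
  rw [← Finset.mul_sum, ← integral_norm_sq_trigPoly, ← intervalIntegral.integral_const_mul] at h1
  have cz := continuous_trigPoly S z
  have c0 : Continuous fun t => h₀ t (trigPoly S z t) := hh₀.comp (continuous_id.prodMk cz)
  have c1 : Continuous fun t => h₁ t (trigPoly S z t) := hh₁.comp (continuous_id.prodMk cz)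
  have h2 : ∫ t in (0:ℝ)..1, (w t - ε) ≤ ∫ t in (0:ℝ)..1, (Real.pi * ‖trigPoly S z t‖ ^ 2 -
      (h₀ t (trigPoly S z t) - 1 * h₁ t (trigPoly S z t))) := by
    refine intervalIntegral.integral_mono_on zero_le_one ?_ ?_ fun t _ => ?_
    · exact (hwc.sub continuous_const).intervalIntegrable _ _
    · exact Continuous.intervalIntegrable (by fun_prop) _ _
    · have := hw t (trigPoly S z t)
      have := (abs_le.1 (hε t (trigPoly S z t))).2
      linarith
  rw [intervalIntegral.integral_sub, intervalIntegral.integral_sub] at h2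
  · simp only [intervalIntegral.integral_const, sub_zero, one_smul] at h2
    unfold action
    linarith
  all_goals exact Continuous.intervalIntegrable (by fun_prop) _ _

/-- Minimax over the trigonometric polynomials of degree `N`: some interpolating action has an
almost critical point on which `h₁` is not small on average. -/
theorem exists_almost_critical [FiniteDimensional ℂ W] {h₀ h₁ : ℝ → W → ℝ} {g₀ g₁ : ℝ → W → W}
    {C₀ l₀ C₁ l₁ : ℝ} (H₀ : TamedHam h₀ g₀ C₀ l₀) (H₁ : TamedHam h₁ g₁ C₁ l₁)
    (ε M κ : ℝ) (w : ℝ → ℝ) (hε : ∀ t x, |h₀ t x| ≤ ε) (hM : ∀ t x, h₁ t x ≤ M)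
    (hwc : Continuous w) (hw : ∀ t x, w t ≤ Real.pi * ‖x‖ ^ 2 + h₁ t x) (hκ0 : 0 ≤ κ)
    (hκ : κ < (∫ t in (0:ℝ)..1, w t) - 2 * ε) (N : ℕ) (δ : ℝ) (hδ : 0 < δ) :
    ∃ s ∈ Icc (0:ℝ) 1, ∃ a : ℤ → W,
      ∑ k ∈ Finset.Icc (-N : ℤ) N,
        ‖actionGrad (Finset.Icc (-N : ℤ) N) (fun t x => g₀ t x - s • g₁ t x) a k‖ ^ 2 < δ ∧
      κ ≤ ∫ t in (0:ℝ)..1, h₁ t (trigPoly (Finset.Icc (-N : ℤ) N) a t) := by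
  set S := Finset.Icc (-N : ℤ) N with hS
  by_contra! hcon
  obtain ⟨τ, hτ, hτl⟩ : ∃ τ : ℝ, 0 < τ ∧ τ * (Real.pi * N + (l₀ + l₁)) ≤ 1 / 2 := by
    refine ⟨1 / (2 * (|Real.pi * N + (l₀ + l₁)| + 1)), by positivity, ?_⟩
    rw [div_mul_eq_mul_div, div_le_div_iff₀ (by positivity) (by norm_num)]
    linarith [le_abs_self (Real.pi * N + (l₀ + l₁))]
  obtain ⟨J, hJ0, hJ⟩ : ∃ J : ℕ, (0 : ℝ) < J ∧ M ≤ J * (τ / 2 * δ) := by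
    obtain ⟨J, hJ⟩ := exists_nat_ge (M / (τ / 2 * δ))
    refine ⟨J + 1, by positivity, ?_⟩
    rw [div_le_iff₀ (by positivity)] at hJ
    push_cast
    nlinarith [mul_pos hτ hδ]
  have hs : ∀ j : ℕ, min ((j : ℝ) / J) 1 ∈ Icc (0:ℝ) 1 := fun j =>
    ⟨le_min (by positivity) zero_le_one, min_le_right _ _⟩
  let G : ℕ → ℝ → W → W := fun j t x => g₀ t x - (min (((j + 1 : ℕ) : ℝ) / J) 1) • g₁ t x
  let k : ℝ → ℝ → W → ℝ := fun s t x => h₀ t x - s * h₁ t x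
  obtain ⟨y, hy, hyJ⟩ := exists_descentSeq_eq_zero N G τ (C₀ + C₁) hτ.le
    (fun j => (H₀.sub_smul H₁ (hs (j + 1))).continuous_grad)
    (fun j => (H₀.sub_smul H₁ (hs (j + 1))).norm_grad_le) J
  have hstep : ∀ j : ℕ, j ≤ J →
      action S (k ((j : ℝ) / J)) (descentSeq S G τ j y) ≤ ε + j * (κ / J) := by
    intro j
    induction j with
    | zero =>
      intro _
      have h0 : k (((0:ℕ) : ℝ) / J) = h₀ := by
        ext t x
        simp [k]
      rw [h0]
      simpa [descentSeq] using action_le_of_nonpos S h₀ y ε H₀.continuous_fun hε hy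
    | succ j ih =>
      intro hj
      have ih := ih (by omega)
      set z := descentSeq S G τ j y
      have hj1 : ((j + 1 : ℕ) : ℝ) / J ≤ 1 := by
        rw [div_le_one hJ0]; exact_mod_cast hj
      have hmin : min (((j + 1 : ℕ) : ℝ) / J) 1 = ((j + 1 : ℕ) : ℝ) / J := min_eq_left hj1
      have hmem : ((j + 1 : ℕ) : ℝ) / J ∈ Icc (0:ℝ) 1 := ⟨by positivity, hj1⟩
      have hd := action_descent (H₀.sub_smul H₁ hmem) N z τ hτ.le hτl
      have hG : G j = fun t x => g₀ t x - (((j + 1 : ℕ) : ℝ) / J) • g₁ t x := by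
        simp only [G, hmin]
      have hz : descentSeq S G τ (j + 1) y = fun k => z k - τ • actionGrad S (G j) z k := rfl
      rw [hz, hG]
      have cz := continuous_trigPoly S z
      have c0 : Continuous fun t => h₀ t (trigPoly S z t) := H₀.continuous_comp cz
      have c1 : Continuous fun t => h₁ t (trigPoly S z t) := H₁.continuous_comp cz
      have hchange : action S (k (((j + 1 : ℕ) : ℝ) / J)) z = action S (k ((j : ℝ) / J)) z +
          1 / J * ∫ t in (0:ℝ)..1, h₁ t (trigPoly S z t) := by
        simp only [action, k]
        rw [intervalIntegral.integral_sub, intervalIntegral.integral_sub,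
          intervalIntegral.integral_const_mul, intervalIntegral.integral_const_mul]
        · push_cast
          ring
        · exact c0.intervalIntegrable _ _
        · exact (continuous_const.mul c1).intervalIntegrable _ _
        · exact c0.intervalIntegrable _ _
        · exact (continuous_const.mul c1).intervalIntegrable _ _
      have hcase := hcon _ hmem z
      set P := ∑ k ∈ S, ‖actionGrad S (fun t x => g₀ t x - (((j + 1 : ℕ) : ℝ) / J) • g₁ t x) z k‖ ^ 2
      have hP0 : 0 ≤ P := Finset.sum_nonneg fun k _ => by positivity
      set Q := ∫ t in (0:ℝ)..1, h₁ t (trigPoly S z t)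
      have hQM : Q ≤ M := by
        have : Q ≤ ∫ t in (0:ℝ)..1, M := intervalIntegral.integral_mono_on zero_le_one
          (c1.intervalIntegrable _ _) (continuous_const.intervalIntegrable _ _) fun t _ => hM t _
        simpa using this
      have hinc : 1 / J * Q - τ / 2 * P ≤ κ / J := by
        rcases lt_or_ge P δ with hP | hP
        · have hQ := (hcase hP).le
          have : 1 / J * Q ≤ κ / J := by
            rw [div_mul_eq_mul_div, one_mul]
            gcongr
          have : 0 ≤ τ / 2 * P := by positivity
          linarith
        · have h1 : 1 / J * Q ≤ τ / 2 * δ := by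
            rw [div_mul_eq_mul_div, one_mul, div_le_iff₀ hJ0]
            linarith
          have h2 : τ / 2 * δ ≤ τ / 2 * P := by gcongr
          have h3 : 0 ≤ κ / J := by positivity
          linarith
      rw [show ((j + 1 : ℕ) : ℝ) * (κ / J) = j * (κ / J) + κ / J by push_cast; ring]
      have hd' : action S (k (((j + 1 : ℕ) : ℝ) / J)) (fun l => z l - τ • actionGrad S
          (fun t x => g₀ t x - (((j + 1 : ℕ) : ℝ) / J) • g₁ t x) z l) ≤
          action S (k (((j + 1 : ℕ) : ℝ) / J)) z - τ / 2 * P := hd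
      linarith
  have hend := hstep J le_rfl
  have hlow := le_action_of_pos N h₀ h₁ (descentSeq S G τ J y) ε w H₀.continuous_fun
    H₁.continuous_fun hε hwc hw hyJ
  have e1 : (J : ℝ) * (κ / J) = κ := by field_simp
  rw [div_self hJ0.ne', e1] at hend
  have hend' : action S (fun t x => h₀ t x - 1 * h₁ t x) (descentSeq S G τ J y) ≤ ε + κ := hend
  linarith

end Descent

section FourierUniqueness

variable {W : Type*} [NormedAddCommGroup W] [InnerProductSpace ℂ W]

theorem eq_zero_of_forall_integral_circleChar_eq_zero (f : ℝ → ℂ) (hf : Continuous f)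
    (hper : f 0 = f 1) (h : ∀ k : ℤ, ∫ t in (0:ℝ)..1, circleChar k t * f t = 0) :
    ∀ t ∈ Icc (0:ℝ) 1, f t = 0 := by
  have : Fact ((0:ℝ) < 1) := ⟨one_pos⟩
  let F : C(AddCircle (1:ℝ), ℂ) :=
    ⟨AddCircle.liftIco 1 0 f, AddCircle.liftIco_zero_continuous hper hf.continuousOn⟩
  have hF : ∀ t ∈ Ico (0:ℝ) 1, F (t : AddCircle (1:ℝ)) = f t := fun t ht =>
    AddCircle.liftIco_zero_coe_apply ht
  have hcoeff : ∀ n, fourierCoeff F n = 0 := by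
    intro n
    rw [fourierCoeff_eq_intervalIntegral _ _ 0, zero_add]
    have h1 : ∫ x in (0:ℝ)..1, fourier (-n) (x : AddCircle (1:ℝ)) • F (x : AddCircle (1:ℝ)) =
        ∫ t in (0:ℝ)..1, circleChar (-n) t * f t := by
      refine intervalIntegral.integral_congr_Ioo_of_le zero_le_one fun x hx => ?_
      rw [hF x (Ioo_subset_Ico_self hx), fourier_coe_apply, smul_eq_mul, circleChar]
      congr 2
      push_cast
      ring
    rw [h1, h, smul_zero]
  have hsum : Summable (fourierCoeff F) := by
    rw [show fourierCoeff F = fun _ => 0 from funext hcoeff]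
    exact summable_zero
  have hzero : ∀ x, F x = 0 := by
    intro x
    have h1 := has_pointwise_sum_fourier_series_of_summable hsum x
    simp only [hcoeff, zero_smul] at h1
    exact h1.unique hasSum_zero
  intro t ht
  rcases ht.2.lt_or_eq with h1 | h1
  · rw [← hF t ⟨ht.1, h1⟩, hzero]
  · rw [h1, ← hper, ← hF 0 ⟨le_rfl, one_pos⟩, hzero]

theorem hasDerivAt_trigPoly (S : Finset ℤ) (a : ℤ → W) (t : ℝ) :
    HasDerivAt (trigPoly S a)
      (trigPoly S (fun k => (2 * Real.pi * k * Complex.I : ℂ) • a k) t) t := by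
  unfold trigPoly
  refine HasDerivAt.fun_sum fun k _ => ?_
  rw [smul_smul, mul_comm]
  exact (hasDerivAt_circleChar k t).smul_const (a k)

theorem trigPoly_zero_eq_one (S : Finset ℤ) (a : ℤ → W) : trigPoly S a 0 = trigPoly S a 1 := by
  simp [trigPoly, circleChar_at_zero, circleChar_at_one]

theorem tendsto_curveCoeff {v : ℕ → ℝ → W} {u : ℝ → W} (C : ℝ) (hv : ∀ n, Continuous (v n))
    (hC : ∀ n, ∀ t ∈ Icc (0:ℝ) 1, ‖v n t‖ ≤ C)
    (h : ∀ t ∈ Icc (0:ℝ) 1, Tendsto (fun n => v n t) atTop (𝓝 (u t))) (k : ℤ) :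
    Tendsto (fun n => curveCoeff (v n) k) atTop (𝓝 (curveCoeff u k)) := by
  refine intervalIntegral.tendsto_integral_filter_of_dominated_convergence (fun _ => C) ?_ ?_
    (continuous_const.intervalIntegrable _ _) ?_
  · exact Eventually.of_forall fun n =>
      ((continuous_circleChar (-k)).smul (hv n)).aestronglyMeasurable
  · refine Eventually.of_forall fun n => ae_of_all _ fun t ht => ?_
    rw [uIoc_of_le zero_le_one] at ht
    rw [norm_smul, norm_circleChar, one_mul]
    exact hC n t (Ioc_subset_Icc_self ht)
  · refine ae_of_all _ fun t ht => ?_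
    rw [uIoc_of_le zero_le_one] at ht
    exact (h t (Ioc_subset_Icc_self ht)).const_smul _

variable [CompleteSpace W]

theorem eq_zero_of_forall_curveCoeff_eq_zero (f : ℝ → W) (hf : Continuous f)
    (hper : f 0 = f 1) (h : ∀ k : ℤ, curveCoeff f k = 0) : ∀ t ∈ Icc (0:ℝ) 1, f t = 0 := by
  intro t ht
  refine ext_inner_left ℂ fun b => ?_
  rw [inner_zero_right]
  refine eq_zero_of_forall_integral_circleChar_eq_zero (fun t => inner ℂ b (f t))
    (continuous_const.inner hf) (by simp only [hper]) (fun k => ?_) t ht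
  have h1 := inner_curveCoeff f hf (-k) b
  rw [h, inner_zero_right] at h1
  rw [h1]
  refine intervalIntegral.integral_congr fun t _ => ?_
  rw [inner_smul_left, conj_circleChar, neg_neg]

theorem norm_trigPoly_sub_le (S : Finset ℤ) (a : ℤ → W) (c : ℝ) (hc : 0 < c) (t u : ℝ)
    (ht : t ∈ Icc (0:ℝ) 1) (hu : u ∈ Icc (0:ℝ) 1) :
    ‖trigPoly S a t - trigPoly S a u‖ ≤
      c / 2 * ∑ k ∈ S, ‖(2 * Real.pi * k : ℝ) • a k‖ ^ 2 + |t - u| / (2 * c) := by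
  wlog hut : u ≤ t generalizing t u
  · rw [norm_sub_rev, abs_sub_comm]
    exact this u t hu ht (le_of_not_ge hut)
  let d : ℤ → W := fun k => (2 * Real.pi * k * Complex.I : ℂ) • a k
  have hd : ∀ k, ‖d k‖ = ‖(2 * Real.pi * k : ℝ) • a k‖ := by
    intro k
    simp [d, norm_smul]
  have cd : Continuous (trigPoly S d) := continuous_trigPoly S d
  have h1 : trigPoly S a t - trigPoly S a u = ∫ s in u..t, trigPoly S d s :=
    (intervalIntegral.integral_eq_sub_of_hasDerivAt (fun s _ => hasDerivAt_trigPoly S a s)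
      (cd.intervalIntegrable _ _)).symm
  have h2 : ∫ s in u..t, ‖trigPoly S d s‖ ≤
      ∫ s in u..t, (c / 2 * ‖trigPoly S d s‖ ^ 2 + 1 / (2 * c)) := by
    refine intervalIntegral.integral_mono_on hut (cd.norm.intervalIntegrable _ _)
      (Continuous.intervalIntegrable (by fun_prop) _ _) fun s _ => ?_
    have : 0 ≤ (c * ‖trigPoly S d s‖ - 1) ^ 2 / (2 * c) := by positivity
    have e : (c * ‖trigPoly S d s‖ - 1) ^ 2 / (2 * c) =
        c / 2 * ‖trigPoly S d s‖ ^ 2 + 1 / (2 * c) - ‖trigPoly S d s‖ := by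
      field_simp
      ring
    linarith
  have h3 : ∫ s in u..t, ‖trigPoly S d s‖ ^ 2 ≤ ∫ s in (0:ℝ)..1, ‖trigPoly S d s‖ ^ 2 :=
    intervalIntegral.integral_mono_interval hu.1 hut ht.2
      (Eventually.of_forall fun s => by positivity) ((cd.norm.pow 2).intervalIntegrable _ _)
  rw [integral_norm_sq_trigPoly] at h3
  simp_rw [hd] at h3
  have c1 : Continuous fun s => c / 2 * ‖trigPoly S d s‖ ^ 2 := by fun_prop
  rw [intervalIntegral.integral_add (c1.intervalIntegrable _ _)
    (continuous_const.intervalIntegrable _ _), intervalIntegral.integral_const_mul,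
    intervalIntegral.integral_const, smul_eq_mul] at h2
  rw [h1, abs_of_nonneg (sub_nonneg.2 hut)]
  refine (intervalIntegral.norm_integral_le_integral_norm hut).trans (h2.trans ?_)
  rw [mul_one_div]
  gcongr

/-- A curve whose Fourier coefficients satisfy the linearised equation solves it. -/
theorem exists_hasDerivAt_of_curveCoeff (z v : ℝ → W) (hz : Continuous z) (hv : Continuous v)
    (hper : z 0 = z 1) (h : ∀ k : ℤ, (2 * Real.pi * k : ℝ) • curveCoeff z k = curveCoeff v k) :
    ∃ y : ℝ → W, (∀ t ∈ Icc (0:ℝ) 1, y t = z t) ∧ ∀ t, HasDerivAt y (Complex.I • v t) t := by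
  let Z : ℝ → W := fun t => ∫ s in (0:ℝ)..t, Complex.I • v s
  have hvI : Continuous fun t => Complex.I • v t := hv.const_smul _
  have hZ : ∀ t, HasDerivAt Z (Complex.I • v t) t := fun t =>
    (hvI.integral_hasStrictDerivAt 0 t).hasDerivAt
  have cZ : Continuous Z := continuous_iff_continuousAt.2 fun t => (hZ t).continuousAt
  have hZ0 : Z 0 = 0 := intervalIntegral.integral_same
  have hZ1 : Z 1 = 0 := by
    have h0 := h 0
    simp [curveCoeff, circleChar_zero] at h0
    simp only [Z]
    rw [intervalIntegral.integral_smul, ← h0, smul_zero]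
  have hcZ : ∀ k : ℤ, (2 * Real.pi * k : ℝ) • curveCoeff Z k = curveCoeff v k := by
    intro k
    have hd : ∀ t, HasDerivAt (fun t => circleChar (-k) t • Z t)
        (circleChar (-k) t • (Complex.I • v t) +
          ((2 * Real.pi * (-k : ℤ) * Complex.I) * circleChar (-k) t) • Z t) t := fun t =>
      (hasDerivAt_circleChar (-k) t).smul (hZ t)
    have cc := continuous_circleChar (-k)
    have c1 : Continuous fun t => circleChar (-k) t • (Complex.I • v t) := cc.smul hvI
    have c2 : Continuous fun t =>
        ((2 * Real.pi * (-k : ℤ) * Complex.I) * circleChar (-k) t) • Z t :=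
      (continuous_const.mul cc).smul cZ
    have h1 := intervalIntegral.integral_eq_sub_of_hasDerivAt (a := 0) (b := 1) (fun t _ => hd t)
      ((c1.add c2).intervalIntegrable _ _)
    rw [hZ0, hZ1, smul_zero, smul_zero, sub_zero, intervalIntegral.integral_add
      (c1.intervalIntegrable _ _) (c2.intervalIntegrable _ _)] at h1
    simp_rw [smul_comm (circleChar (-k) _) Complex.I, ← smul_smul
      (2 * Real.pi * ((-k : ℤ) : ℂ) * Complex.I)] at h1
    rw [intervalIntegral.integral_smul, intervalIntegral.integral_smul] at h1
    change Complex.I • curveCoeff v k +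
      (2 * Real.pi * ((-k : ℤ) : ℂ) * Complex.I) • curveCoeff Z k = 0 at h1
    have h2 : Complex.I • (curveCoeff v k - (2 * Real.pi * k : ℝ) • curveCoeff Z k) = 0 := by
      rw [← h1, smul_sub, sub_eq_add_neg, ← Complex.coe_smul, smul_smul,
        ← neg_smul]
      congr 2
      push_cast
      ring
    exact (sub_eq_zero.1 ((smul_eq_zero.1 h2).resolve_left Complex.I_ne_zero)).symm
  let b : W := curveCoeff (fun t => z t - Z t) 0
  have hsub : ∀ k, curveCoeff (fun t => z t - Z t) k = curveCoeff z k - curveCoeff Z k := by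
    intro k
    unfold curveCoeff
    simp_rw [smul_sub]
    exact intervalIntegral.integral_sub
      (((continuous_circleChar (-k)).smul hz).intervalIntegrable _ _)
      (((continuous_circleChar (-k)).smul cZ).intervalIntegrable _ _)
  have hzero := eq_zero_of_forall_curveCoeff_eq_zero (fun t => (z t - Z t) - b)
    ((hz.sub cZ).sub continuous_const) (by simp only [hZ0, hZ1, hper]) (fun k => by
      have e : curveCoeff (fun t => (z t - Z t) - b) k =
          curveCoeff (fun t => z t - Z t) k - if k = 0 then b else 0 := by
        have cc := continuous_circleChar (-k)
        have h1 := intervalIntegral.integral_sub (μ := volume) (a := 0) (b := 1)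
          ((cc.smul (hz.sub cZ)).intervalIntegrable _ _)
          ((cc.smul (continuous_const (y := b))).intervalIntegrable _ _)
        unfold curveCoeff
        simp_rw [smul_sub _ (z _ - Z _) b]
        refine h1.trans ?_
        change _ - ∫ x in (0:ℝ)..1, circleChar (-k) x • b = _
        rw [intervalIntegral.integral_smul_const, integral_circleChar]
        congr 1
        by_cases hk : k = 0 <;> simp [hk]
      rw [e]
      by_cases hk : k = 0
      · subst hk
        simp [b]
      · rw [if_neg hk, sub_zero, hsub, sub_eq_zero]
        have h3 : (2 * Real.pi * k : ℝ) ≠ 0 := by simp [Real.pi_ne_zero, hk]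
        exact smul_right_injective W h3 ((h k).trans (hcZ k).symm))
  refine ⟨fun t => Z t + b, fun t ht => ?_, fun t => (hZ t).add_const b⟩
  have := hzero t ht
  rw [sub_sub, sub_eq_zero] at this
  exact this.symm

end FourierUniqueness

section PeriodicOrbit

variable {W : Type*} [NormedAddCommGroup W] [InnerProductSpace ℂ W]

/-- Sequences of curves with a common square-root type modulus of continuity, and passing through a
fixed ball, subconverge. -/
theorem exists_subseq_tendsto [FiniteDimensional ℂ W] (z : ℕ → ℝ → W)
    (hz : ∀ n, Continuous (z n)) (B r : ℝ)
    (hmod : ∀ n, ∀ c > 0, ∀ t ∈ Icc (0:ℝ) 1, ∀ u ∈ Icc (0:ℝ) 1,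
      ‖z n t - z n u‖ ≤ c / 2 * B + |t - u| / (2 * c))
    (hr : ∀ n, ∃ t ∈ Icc (0:ℝ) 1, ‖z n t‖ ≤ r) (s : ℕ → ℝ) (hs : ∀ n, s n ∈ Icc (0:ℝ) 1) :
    ∃ (y : ℝ → W) (σ : ℝ) (ψ : ℕ → ℕ), Continuous y ∧ σ ∈ Icc (0:ℝ) 1 ∧ StrictMono ψ ∧
      Tendsto (fun n => s (ψ n)) atTop (𝓝 σ) ∧
      ∀ t ∈ Icc (0:ℝ) 1, Tendsto (fun n => z (ψ n) t) atTop (𝓝 (y t)) := by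
  have : ProperSpace W := FiniteDimensional.proper ℂ W
  let f : ℕ → BoundedContinuousFunction (Icc (0:ℝ) 1) W := fun n =>
    BoundedContinuousFunction.mkOfCompact ⟨fun t => z n t, (hz n).comp continuous_subtype_val⟩
  let A : Set (BoundedContinuousFunction (Icc (0:ℝ) 1) W) := range f
  have hcomp : IsCompact (closure A) := by
    refine BoundedContinuousFunction.arzela_ascoli (closedBall (0 : W) (r + (1 / 2 * B + 1 / 2)))
      (isCompact_closedBall _ _) A ?_ ?_
    · rintro _ t ⟨n, rfl⟩
      rw [mem_closedBall_zero_iff]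
      obtain ⟨u, hu, hur⟩ := hr n
      have h1 := hmod n 1 one_pos t t.2 u hu
      have h2 : |(t : ℝ) - u| ≤ 1 := by
        rw [abs_le]
        constructor <;> linarith [t.2.1, t.2.2, hu.1, hu.2]
      have h3 : ‖z n t‖ ≤ ‖z n u‖ + ‖z n t - z n u‖ := norm_le_norm_add_norm_sub' _ _
      change ‖z n t‖ ≤ _
      linarith
    · intro t₀
      rw [Metric.equicontinuousAt_iff]
      intro ε hε
      obtain ⟨c, hc, hcB⟩ : ∃ c : ℝ, 0 < c ∧ c / 2 * B < ε / 2 := by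
        refine ⟨ε / (|B| + 1), by positivity, ?_⟩
        have h1 : ε / (|B| + 1) / 2 * B = ε / 2 * (B / (|B| + 1)) := by ring
        rw [h1]
        refine mul_lt_of_lt_one_right (by positivity) ?_
        rw [div_lt_one (by positivity)]
        linarith [le_abs_self B]
      refine ⟨c * ε, by positivity, ?_⟩
      rintro t ht ⟨_, n, rfl⟩
      rw [dist_eq_norm]
      change ‖z n t₀ - z n t‖ < ε
      have h1 := hmod n c hc t₀ t₀.2 t t.2
      have h2 : |(t₀ : ℝ) - t| < c * ε := by
        rw [abs_sub_comm]; exact ht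
      have h3 : |(t₀ : ℝ) - t| / (2 * c) < ε / 2 := by
        rw [div_lt_div_iff₀ (by positivity) two_pos]
        linarith
      linarith
  obtain ⟨⟨σ, y⟩, hmem, ψ, hψ, hlim⟩ := (isCompact_Icc.prod hcomp).tendsto_subseq
    (x := fun n => ((s n, f n) : ℝ × BoundedContinuousFunction (Icc (0:ℝ) 1) W))
    fun n => ⟨hs n, subset_closure ⟨n, rfl⟩⟩
  rw [nhds_prod_eq] at hlim
  refine ⟨IccExtend zero_le_one y, σ, ψ, y.continuous.Icc_extend', hmem.1, hψ,
    hlim.fst, fun t ht => ?_⟩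
  rw [IccExtend_of_mem _ _ ht]
  exact ((continuous_eval_const (⟨t, ht⟩ : Icc (0:ℝ) 1)).tendsto y).comp
    hlim.snd

variable [CompleteSpace W]

/-- Almost critical trigonometric polynomials have bounded energy. -/
theorem sum_norm_sq_le_of_actionGrad (S : Finset ℤ) (g : ℝ → W → W) (C : ℝ)
    (hg : Continuous fun p : ℝ × W => g p.1 p.2) (hC : ∀ t x, ‖g t x‖ ≤ C) (a : ℤ → W)
    (ha : ∑ k ∈ S, ‖actionGrad S g a k‖ ^ 2 ≤ 1) :
    ∑ k ∈ S, ‖(2 * Real.pi * k : ℝ) • a k‖ ^ 2 ≤ 2 * (1 + C ^ 2) := by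
  let v : ℝ → W := fun t => g t (trigPoly S a t)
  have hv : Continuous v := hg.comp (continuous_id.prodMk (continuous_trigPoly S a))
  have h1 : ∑ k ∈ S, ‖curveCoeff v k‖ ^ 2 ≤ C ^ 2 := by
    refine (sum_norm_sq_curveCoeff_le S v hv).trans ?_
    have : ∫ t in (0:ℝ)..1, ‖v t‖ ^ 2 ≤ ∫ t in (0:ℝ)..1, C ^ 2 :=
      intervalIntegral.integral_mono_on zero_le_one ((hv.norm.pow 2).intervalIntegrable _ _)
        (continuous_const.intervalIntegrable _ _) fun t _ =>
          pow_le_pow_left₀ (norm_nonneg _) (hC _ _) 2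
    simpa using this
  have h2 : ∀ k ∈ S, ‖(2 * Real.pi * k : ℝ) • a k‖ ^ 2 ≤
      2 * ‖actionGrad S g a k‖ ^ 2 + 2 * ‖curveCoeff v k‖ ^ 2 := by
    intro k _
    have e : (2 * Real.pi * k : ℝ) • a k = actionGrad S g a k + curveCoeff v k := by
      simp [actionGrad, v]
    rw [e]
    have := norm_add_le (actionGrad S g a k) (curveCoeff v k)
    have h3 := pow_le_pow_left₀ (norm_nonneg _) this 2
    nlinarith [sq_nonneg (‖actionGrad S g a k‖ - ‖curveCoeff v k‖)]
  refine (Finset.sum_le_sum h2).trans ?_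
  rw [Finset.sum_add_distrib, ← Finset.mul_sum, ← Finset.mul_sum]
  linarith

/-- Existence of a 1-periodic orbit of some interpolating Hamiltonian `h₀ - s h₁` which sees `h₁`. -/
theorem exists_periodic_orbit [FiniteDimensional ℂ W] {h₀ h₁ : ℝ → W → ℝ} {g₀ g₁ : ℝ → W → W}
    {C₀ l₀ C₁ l₁ : ℝ} (H₀ : TamedHam h₀ g₀ C₀ l₀) (H₁ : TamedHam h₁ g₁ C₁ l₁)
    (ε M κ r : ℝ) (w : ℝ → ℝ) (hε : ∀ t x, |h₀ t x| ≤ ε) (hM0 : ∀ t x, 0 ≤ h₁ t x)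
    (hM : ∀ t x, h₁ t x ≤ M) (hsupp : ∀ t x, r ≤ ‖x‖ → h₁ t x = 0)
    (hwc : Continuous w) (hw : ∀ t x, w t ≤ Real.pi * ‖x‖ ^ 2 + h₁ t x) (hκ0 : 0 < κ)
    (hκ : κ < (∫ t in (0:ℝ)..1, w t) - 2 * ε) :
    ∃ s : ℝ, ∃ y : ℝ → W, (∀ t ∈ Icc (0:ℝ) 1,
      HasDerivAt y (Complex.I • (g₀ t (y t) - s • g₁ t (y t))) t) ∧ y 0 = y 1 ∧
      0 < ∫ t in (0:ℝ)..1, h₁ t (y t) := by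
  have hex := fun N : ℕ => exists_almost_critical H₀ H₁ ε M κ w hε hM hwc hw hκ0.le hκ N
    (1 / ((N : ℝ) + 1)) (by positivity)
  choose s hs a ha hκa using hex
  let S : ℕ → Finset ℤ := fun N => Finset.Icc (-N : ℤ) N
  let z : ℕ → ℝ → W := fun N => trigPoly (S N) (a N)
  let g : ℕ → ℝ → W → W := fun N t x => g₀ t x - s N • g₁ t x
  have hz : ∀ N, Continuous (z N) := fun N => continuous_trigPoly _ _
  have hT := fun N => H₀.sub_smul H₁ (hs N)
  have hmod : ∀ n, ∀ c > 0, ∀ t ∈ Icc (0:ℝ) 1, ∀ u ∈ Icc (0:ℝ) 1,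
      ‖z n t - z n u‖ ≤ c / 2 * (2 * (1 + (C₀ + C₁) ^ 2)) + |t - u| / (2 * c) := by
    intro n c hc t ht u hu
    refine (norm_trigPoly_sub_le (S n) (a n) c hc t u ht hu).trans ?_
    gcongr
    refine sum_norm_sq_le_of_actionGrad (S n) (g n) (C₀ + C₁) (hT n).continuous_grad
      (hT n).norm_grad_le (a n) ((ha n).le.trans ?_)
    rw [div_le_one (by positivity)]
    linarith [(Nat.cast_nonneg n : (0:ℝ) ≤ n)]
  have hr : ∀ n, ∃ t ∈ Icc (0:ℝ) 1, ‖z n t‖ ≤ r := by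
    intro n
    by_contra! hcon
    have h1 : ∫ t in (0:ℝ)..1, h₁ t (z n t) = ∫ t in (0:ℝ)..1, (0:ℝ) := by
      refine intervalIntegral.integral_congr fun t ht => ?_
      rw [uIcc_of_le zero_le_one] at ht
      exact hsupp t _ (hcon t ht).le
    have h2 := hκa n
    change κ ≤ ∫ t in (0:ℝ)..1, h₁ t (z n t) at h2
    rw [h1] at h2
    simp at h2
    linarith
  obtain ⟨y, σ, ψ, hy, hσ, hψ, hsσ, hzy⟩ := exists_subseq_tendsto z hz _ r hmod hr s hs
  let v : ℝ → W := fun t => g₀ t (y t) - σ • g₁ t (y t)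
  have hv : Continuous v := (H₀.sub_smul H₁ hσ).continuous_grad_comp hy
  have hvn : ∀ n, Continuous fun t => g n t (z n t) := fun n => (hT n).continuous_grad_comp (hz n)
  have hlimv : ∀ t ∈ Icc (0:ℝ) 1,
      Tendsto (fun n => g (ψ n) t (z (ψ n) t)) atTop (𝓝 (v t)) := by
    intro t ht
    have e0 : Continuous (g₀ t) := H₀.continuous_grad.comp (continuous_const.prodMk continuous_id)
    have e1 : Continuous (g₁ t) := H₁.continuous_grad.comp (continuous_const.prodMk continuous_id)
    exact ((e0.tendsto _).comp (hzy t ht)).sub (hsσ.smul ((e1.tendsto _).comp (hzy t ht)))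
  have hzbound : ∀ n, ∀ t ∈ Icc (0:ℝ) 1,
      ‖z n t‖ ≤ r + (1 / 2 * (2 * (1 + (C₀ + C₁) ^ 2)) + 1 / 2) := by
    intro n t ht
    obtain ⟨u, hu, hur⟩ := hr n
    have h1 := hmod n 1 one_pos t ht u hu
    have h2 : |t - u| ≤ 1 := by
      rw [abs_le]
      constructor <;> linarith [ht.1, ht.2, hu.1, hu.2]
    have h3 : ‖z n t‖ ≤ ‖z n u‖ + ‖z n t - z n u‖ := norm_le_norm_add_norm_sub' _ _
    linarith
  have hcoeff : ∀ k : ℤ, (2 * Real.pi * k : ℝ) • curveCoeff y k = curveCoeff v k := by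
    intro k
    have l1 := tendsto_curveCoeff _ (fun n => hz (ψ n)) (fun n => hzbound (ψ n)) hzy k
    have l2 := tendsto_curveCoeff (C₀ + C₁) (fun n => hvn (ψ n))
      (fun n t _ => (hT (ψ n)).norm_grad_le t _) hlimv k
    have l3 := (l1.const_smul (2 * Real.pi * k : ℝ)).sub l2
    have l4 : Tendsto (fun n => (2 * Real.pi * k : ℝ) • curveCoeff (z (ψ n)) k -
        curveCoeff (fun t => g (ψ n) t (z (ψ n) t)) k) atTop (𝓝 0) := by
      have hsq : Tendsto (fun n : ℕ => Real.sqrt (1 / ((ψ n : ℝ) + 1))) atTop (𝓝 0) := by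
        have := (tendsto_one_div_add_atTop_nhds_zero_nat (𝕜 := ℝ)).comp hψ.tendsto_atTop
        have h2 := (Real.continuous_sqrt.tendsto 0).comp this
        rw [Real.sqrt_zero] at h2
        exact h2
      refine squeeze_zero_norm' ?_ hsq
      filter_upwards [hψ.tendsto_atTop.eventually_ge_atTop k.natAbs] with n hn
      have hk : k ∈ S (ψ n) := by
        simp only [S, Finset.mem_Icc]
        omega
      have e : (2 * Real.pi * k : ℝ) • curveCoeff (z (ψ n)) k -
          curveCoeff (fun t => g (ψ n) t (z (ψ n) t)) k =
          actionGrad (S (ψ n)) (g (ψ n)) (a (ψ n)) k := by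
        rw [curveCoeff_trigPoly, if_pos hk, actionGrad]
      rw [e]
      refine Real.le_sqrt_of_sq_le ((Finset.single_le_sum
        (f := fun k => ‖actionGrad (S (ψ n)) (g (ψ n)) (a (ψ n)) k‖ ^ 2)
        (fun k _ => by positivity) hk).trans (ha (ψ n)).le)
    exact sub_eq_zero.1 (tendsto_nhds_unique l3 l4)
  have hper : y 0 = y 1 := by
    have l0 := hzy 0 ⟨le_rfl, zero_le_one⟩
    have l1 := hzy 1 ⟨zero_le_one, le_rfl⟩
    refine tendsto_nhds_unique l0 (l1.congr fun n => ?_)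
    exact (trigPoly_zero_eq_one _ _).symm
  obtain ⟨x, hxy, hx⟩ := exists_hasDerivAt_of_curveCoeff y v hy hv hper hcoeff
  refine ⟨σ, x, fun t ht => ?_, ?_, ?_⟩
  · rw [hxy t ht]
    exact hx t
  · rw [hxy 0 ⟨le_rfl, zero_le_one⟩, hxy 1 ⟨zero_le_one, le_rfl⟩, hper]
  · have e : ∫ t in (0:ℝ)..1, h₁ t (x t) = ∫ t in (0:ℝ)..1, h₁ t (y t) := by
      refine intervalIntegral.integral_congr fun t ht => ?_
      rw [uIcc_of_le zero_le_one] at ht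
      simp only [hxy t ht]
    rw [e]
    have hlim : Tendsto (fun n => ∫ t in (0:ℝ)..1, h₁ t (z (ψ n) t)) atTop
        (𝓝 (∫ t in (0:ℝ)..1, h₁ t (y t))) := by
      refine intervalIntegral.tendsto_integral_filter_of_dominated_convergence (fun _ => M) ?_ ?_
        (continuous_const.intervalIntegrable _ _) ?_
      · exact Eventually.of_forall fun n => (H₁.continuous_comp (hz (ψ n))).aestronglyMeasurable
      · refine Eventually.of_forall fun n => ae_of_all _ fun t _ => ?_
        rw [Real.norm_of_nonneg (hM0 _ _)]
        exact hM _ _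
      · refine ae_of_all _ fun t ht => ?_
        rw [uIoc_of_le zero_le_one] at ht
        have e1 : Continuous (h₁ t) :=
          H₁.continuous_fun.comp (continuous_const.prodMk continuous_id)
        exact (e1.tendsto _).comp (hzy t (Ioc_subset_Icc_self ht))
    exact hκ0.trans_le (ge_of_tendsto' hlim fun n => hκa (ψ n))

end PeriodicOrbit

section Cutoff

theorem ContDiff.taylor_bound_of_hasCompactSupport {E : Type*} [NormedAddCommGroup E]
    [NormedSpace ℝ E] {f : E → ℝ} (hf : ContDiff ℝ 2 f) (hs : HasCompactSupport f) :
    ∃ L : NNReal, (∀ x, ‖fderiv ℝ f x‖ ≤ L) ∧ LipschitzWith L (fderiv ℝ f) ∧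
      ∀ x u, |f (x + u) - f x - fderiv ℝ f x u| ≤ L * ‖u‖ ^ 2 := by
  have h1 : ContDiff ℝ 1 (fderiv ℝ f) := hf.fderiv_right (by norm_num)
  have hs1 : HasCompactSupport (fderiv ℝ f) := hs.fderiv ℝ
  obtain ⟨L₁, hL₁⟩ := h1.lipschitzWith_of_hasCompactSupport hs1 one_ne_zero
  obtain ⟨C, hC⟩ := hs1.exists_bound_of_continuous h1.continuous
  refine ⟨max L₁ C.toNNReal, fun x => (hC x).trans ?_, hL₁.weaken (le_max_left _ _), fun x u => ?_⟩
  · rw [NNReal.coe_max]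
    exact (Real.le_coe_toNNReal C).trans (le_max_right _ _)
  · have key := (convex_closedBall x ‖u‖).norm_image_sub_le_of_norm_hasFDerivWithin_le'
      (f := f) (f' := fderiv ℝ f) (φ := fderiv ℝ f x) (C := L₁ * ‖u‖) (x := x) (y := x + u)
      (fun z _ => ((hf.differentiable (by norm_num)) z).hasFDerivAt.hasFDerivWithinAt)
      (fun z hz => by
        rw [← dist_eq_norm]
        exact (hL₁.dist_le_mul z x).trans
          (mul_le_mul_of_nonneg_left (mem_closedBall.1 hz) L₁.2))
      (mem_closedBall_self (norm_nonneg _)) (by simp)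
    rw [add_sub_cancel_left, Real.norm_eq_abs] at key
    refine key.trans ?_
    rw [mul_assoc, ← pow_two]
    exact mul_le_mul_of_nonneg_right (by rw [NNReal.coe_max]; exact le_max_left _ _) (sq_nonneg _)

end Cutoff

section TimeChange

variable {W : Type*} [NormedAddCommGroup W] [InnerProductSpace ℂ W]
  {h : ℝ → W → ℝ} {g : ℝ → W → W} {C l : ℝ}

theorem TamedHam.timeChange (H : TamedHam h g C l) {a θ : ℝ → ℝ} {A : ℝ} (ha : Continuous a)
    (hA : ∀ t, |a t| ≤ A) (hθ : Continuous θ) :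
    TamedHam (fun t x => a t * h (θ t) x) (fun t x => a t • g (θ t) x) (A * C) (A * l) where
  continuous_fun := (ha.comp continuous_fst).mul
    (H.continuous_fun.comp ((hθ.comp continuous_fst).prodMk continuous_snd))
  continuous_grad := (ha.comp continuous_fst).smul
    (H.continuous_grad.comp ((hθ.comp continuous_fst).prodMk continuous_snd))
  norm_grad_le t x := by
    rw [norm_smul, Real.norm_eq_abs]
    exact mul_le_mul (hA t) (H.norm_grad_le _ _) (norm_nonneg _) ((abs_nonneg _).trans (hA t))
  taylor t x u := by
    have e : (inner ℂ (a t • g (θ t) x) u).re = a t * (inner ℂ (g (θ t) x) u).re := by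
      rw [← Complex.coe_smul (a t), inner_smul_left, Complex.conj_ofReal, Complex.re_ofReal_mul]
    rw [e, ← mul_sub, ← mul_sub, abs_mul, mul_assoc]
    exact mul_le_mul (hA t) (H.taylor _ _ _) (abs_nonneg _) ((abs_nonneg _).trans (hA t))

end TimeChange

section NonDisplacement

variable {W : Type*} [NormedAddCommGroup W] [InnerProductSpace ℂ W] [FiniteDimensional ℂ W]

theorem exists_radial_tamedHam {r : ℝ} (hr : 0 < r) :
    ∃ (b c : W → ℝ) (C l : ℝ), TamedHam (fun _ => b) (fun _ x => c x • x) C l ∧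
      (∀ x, 0 ≤ b x) ∧ (∀ x, b x ≤ r ^ 2 / 4) ∧ (∀ x, r ≤ ‖x‖ → b x = 0) ∧
      ∀ x, r ^ 2 / 4 ≤ ‖x‖ ^ 2 + b x := by
  let _ : InnerProductSpace ℝ W := InnerProductSpace.complexToReal
  have : ProperSpace W := FiniteDimensional.proper ℂ W
  let p : ℝ → ℝ := fun s => r ^ 2 / 4 * Real.smoothTransition ((r ^ 2 - s) / (3 * r ^ 2 / 4))
  have hp : ContDiff ℝ 2 p := by
    refine contDiff_const.mul (Real.smoothTransition.contDiff.comp ?_)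
    exact (contDiff_const.sub contDiff_id).div_const _
  have hb : ContDiff ℝ 2 (fun x : W => p (‖x‖ ^ 2)) := hp.comp (contDiff_norm_sq ℝ)
  have hz : ∀ x : W, r ≤ ‖x‖ → p (‖x‖ ^ 2) = 0 := fun x hx => by
    have : Real.smoothTransition ((r ^ 2 - ‖x‖ ^ 2) / (3 * r ^ 2 / 4)) = 0 :=
      Real.smoothTransition.zero_of_nonpos
        (div_nonpos_of_nonpos_of_nonneg (by nlinarith) (by positivity))
    simp [p, this]
  have hs : HasCompactSupport (fun x : W => p (‖x‖ ^ 2)) :=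
    HasCompactSupport.intro (isCompact_closedBall (0 : W) r) fun x hx => hz x (by
      rw [mem_closedBall_zero_iff, not_le] at hx; exact hx.le)
  obtain ⟨L, hL, -, hT⟩ := hb.taylor_bound_of_hasCompactSupport hs
  have hD : ∀ x u : W, fderiv ℝ (fun x : W => p (‖x‖ ^ 2)) x u =
      (inner ℂ ((2 * deriv p (‖x‖ ^ 2)) • x) u).re := fun x u => by
    have h1 := (hp.differentiable (by norm_num) (‖x‖ ^ 2)).hasDerivAt.comp_hasFDerivAt x
      (hasStrictFDerivAt_norm_sq x).hasFDerivAt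
    have h2 : fderiv ℝ (fun x : W => p (‖x‖ ^ 2)) x = _ := h1.fderiv
    rw [h2, ← Complex.coe_smul, inner_smul_left, Complex.conj_ofReal, Complex.re_ofReal_mul]
    simp only [smul_apply, innerSL_apply_apply, smul_eq_mul, nsmul_eq_mul]
    rw [show inner ℝ x u = (inner ℂ x u).re from rfl]
    push_cast
    ring
  have hst := fun x => Real.smoothTransition.nonneg x
  refine ⟨fun x => p (‖x‖ ^ 2), fun x => 2 * deriv p (‖x‖ ^ 2), L, L, ?_, ?_, ?_, hz, ?_⟩
  · refine ⟨hb.continuous.comp continuous_snd, ?_, fun _ x => ?_, fun _ x u => ?_⟩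
    · have : Continuous (deriv p) := hp.continuous_deriv (by norm_num)
      fun_prop
    · set g := (2 * deriv p (‖x‖ ^ 2)) • x with hg
      have h1 : ‖g‖ ^ 2 ≤ L * ‖g‖ := by
        have h2 : ‖g‖ ^ 2 = fderiv ℝ (fun x : W => p (‖x‖ ^ 2)) x g := by
          rw [hD, ← hg, inner_self_eq_norm_sq_to_K]
          norm_cast
        rw [h2]
        exact (Real.le_norm_self _).trans (((fderiv ℝ _ x).le_opNorm g).trans
          (mul_le_mul_of_nonneg_right (hL x) (norm_nonneg _)))
      by_contra! hlt
      nlinarith [L.2.trans_lt hlt]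
    · rw [← hD]
      exact hT x u
  · exact fun x => mul_nonneg (by positivity) (hst _)
  · exact fun x => mul_le_of_le_one_right (by positivity) (Real.smoothTransition.le_one _)
  · intro x
    rcases le_total (r / 2) ‖x‖ with h | h
    · have := mul_nonneg (by positivity : 0 ≤ r ^ 2 / 4)
        (hst ((r ^ 2 - ‖x‖ ^ 2) / (3 * r ^ 2 / 4)))
      simp only [p]
      nlinarith
    · have : Real.smoothTransition ((r ^ 2 - ‖x‖ ^ 2) / (3 * r ^ 2 / 4)) = 1 :=
        Real.smoothTransition.one_of_one_le (by
          rw [le_div_iff₀ (by positivity)]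
          nlinarith [norm_nonneg x])
      simp only [p, this]
      nlinarith [norm_nonneg x]

/-- A flow generated by a Hamiltonian of small oscillation cannot displace the ball of radius `r`,
in the following weak form: some trajectory starting in the ball ends in the ball. -/
theorem TamedHam.exists_trajectory_returning {G : ℝ → W → ℝ} {g : ℝ → W → W} {C l : ℝ}
    (H : TamedHam G g C l) {L : NNReal} (hL : ∀ t, LipschitzWith L (g t)) {ε r T : ℝ}
    (hε : ∀ t ∈ Icc (0 : ℝ) 1, ∀ x, |G t x| ≤ ε) (hr : 0 < r)
    (hεr : 2 * (Real.pi * ε) < r ^ 2 / 4) (hT : T ∈ Ioc (0 : ℝ) 1) :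
    ∃ p q : W, ‖p‖ < r ∧ ‖q‖ < r ∧ ∀ x : ℝ → W, x 0 = p →
      (∀ t ∈ Icc (0 : ℝ) T, HasDerivAt x (Complex.I • g t (x t)) t) → x T = q := by
  let _ : InnerProductSpace ℝ W := InnerProductSpace.complexToReal
  have : CompleteSpace W := FiniteDimensional.complete ℂ W
  obtain ⟨b, c, C₁, l₁, hb, hb0, hbm, hbz, hbr⟩ := exists_radial_tamedHam (W := W) hr
  have hpi := Real.pi_pos
  let w₁ : ℝ → ℝ := fun t => Real.pi * max (Real.sin (2 * Real.pi * t)) 0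
  let w₂ : ℝ → ℝ := fun t => Real.pi * max (-Real.sin (2 * Real.pi * t)) 0
  let τ : ℝ → ℝ := fun t => (1 - Real.cos (2 * Real.pi * t)) / 2
  have hw₁c : Continuous w₁ := by fun_prop
  have hw₂c : Continuous w₂ := by fun_prop
  have hτc : Continuous τ := by fun_prop
  have hw₁0 : ∀ t, 0 ≤ w₁ t := fun t => mul_nonneg hpi.le (le_max_right _ _)
  have hw₂0 : ∀ t, 0 ≤ w₂ t := fun t => mul_nonneg hpi.le (le_max_right _ _)
  have hw₁p : ∀ t, w₁ t ≤ Real.pi := fun t =>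
    mul_le_of_le_one_right hpi.le (max_le (Real.sin_le_one _) zero_le_one)
  have hw₂p : ∀ t, w₂ t ≤ Real.pi := fun t =>
    mul_le_of_le_one_right hpi.le (max_le (by linarith [Real.neg_one_le_sin (2 * Real.pi * t)])
      zero_le_one)
  have hτ : ∀ t, HasDerivAt τ (Real.pi * Real.sin (2 * Real.pi * t)) t := fun t => by
    have h1 : HasDerivAt (fun t : ℝ => 2 * Real.pi * t) (2 * Real.pi) t := by
      simpa using (hasDerivAt_id t).const_mul (2 * Real.pi)
    exact (((h1.cos).const_sub 1).div_const 2).congr_deriv (by ring)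
  have hs0 : ∀ t ∈ Icc (0 : ℝ) (1 / 2), 0 ≤ Real.sin (2 * Real.pi * t) := fun t ht =>
    Real.sin_nonneg_of_nonneg_of_le_pi (by have := ht.1; positivity) (by nlinarith [ht.2])
  have hs1 : ∀ t ∈ Icc (1 / 2 : ℝ) 1, Real.sin (2 * Real.pi * t) ≤ 0 := fun t ht => by
    have := Real.sin_nonneg_of_nonneg_of_le_pi (x := 2 * Real.pi * t - Real.pi)
      (by nlinarith [ht.1]) (by nlinarith [ht.2])
    rw [Real.sin_sub_pi] at this
    linarith
  have hw₁l : ∀ t ∈ Icc (0 : ℝ) (1 / 2), w₁ t = Real.pi * Real.sin (2 * Real.pi * t) :=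
    fun t ht => by simp only [w₁, max_eq_left (hs0 t ht)]
  have hw₁r : ∀ t ∈ Icc (1 / 2 : ℝ) 1, w₁ t = 0 := fun t ht => by
    simp only [w₁, max_eq_right (hs1 t ht), mul_zero]
  have hw₂l : ∀ t ∈ Icc (0 : ℝ) (1 / 2), w₂ t = 0 := fun t ht => by
    simp only [w₂, max_eq_right (neg_nonpos.2 (hs0 t ht)), mul_zero]
  have hw₂r : ∀ t ∈ Icc (1 / 2 : ℝ) 1, w₂ t = -(Real.pi * Real.sin (2 * Real.pi * t)) :=
    fun t ht => by simp only [w₂, max_eq_left (neg_nonneg.2 (hs1 t ht)), mul_neg]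
  have hτ0 : τ 0 = 0 := by simp [τ]
  have hτh : τ (1 / 2) = 1 := by
    simp only [τ]; rw [show 2 * Real.pi * (1 / 2) = Real.pi by ring, Real.cos_pi]; norm_num
  have hτ1 : τ 1 = 0 := by simp [τ]
  have hτm : ∀ t, T * τ t ∈ Icc (0 : ℝ) T := fun t => by
    have h1 := Real.cos_le_one (2 * Real.pi * t)
    have h2 := Real.neg_one_le_cos (2 * Real.pi * t)
    constructor
    · exact mul_nonneg hT.1.le (by simp only [τ]; linarith)
    · exact mul_le_of_le_one_right hT.1.le (by simp only [τ]; linarith)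
  have hInt : ∫ t in (0 : ℝ)..1, w₂ t = 1 := by
    rw [← intervalIntegral.integral_add_adjacent_intervals
      (hw₂c.intervalIntegrable 0 (1 / 2)) (hw₂c.intervalIntegrable (1 / 2) 1)]
    rw [intervalIntegral.integral_congr (g := fun _ => (0 : ℝ)) (a := 0) (b := 1 / 2)
      fun t ht => hw₂l t (by rwa [uIcc_of_le (by norm_num)] at ht)]
    rw [intervalIntegral.integral_congr (a := 1 / 2) (b := 1)
      fun t ht => hw₂r t (by rwa [uIcc_of_le (by norm_num)] at ht)]
    rw [intervalIntegral.integral_eq_sub_of_hasDerivAt (f := fun t => -τ t)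
      (fun t _ => (hτ t).neg) (by apply Continuous.intervalIntegrable; fun_prop)]
    rw [hτ1, hτh]; norm_num
  have hε0 : 0 ≤ ε := (abs_nonneg _).trans (hε 0 ⟨le_rfl, zero_le_one⟩ 0)
  have hTw : ∀ t, |T * w₁ t| ≤ Real.pi := fun t => by
    rw [abs_of_nonneg (mul_nonneg hT.1.le (hw₁0 t))]
    exact (mul_le_of_le_one_left (hw₁0 t) hT.2).trans (hw₁p t)
  have H₀ := H.timeChange (a := fun t => T * w₁ t) (θ := fun t => T * τ t) (by fun_prop) hTw
    (by fun_prop)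
  have H₁ := hb.timeChange (a := w₂) (θ := fun t => t) hw₂c
    (fun t => by rw [abs_of_nonneg (hw₂0 t)]; exact hw₂p t) (by fun_prop)
  obtain ⟨s, y, hy, hy01, hpos⟩ := exists_periodic_orbit H₀ H₁ (Real.pi * ε)
    (Real.pi * (r ^ 2 / 4)) ((r ^ 2 / 4 - 2 * (Real.pi * ε)) / 2) r (fun t => w₂ t * (r ^ 2 / 4))
    (fun t x => by
      rw [abs_mul]
      exact mul_le_mul (hTw t) (hε _ ⟨(hτm t).1, (hτm t).2.trans hT.2⟩ _) (abs_nonneg _) hpi.le)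
    (fun t x => mul_nonneg (hw₂0 t) (hb0 x))
    (fun t x => mul_le_mul (hw₂p t) (hbm x) (hb0 x) hpi.le)
    (fun t x hx => by rw [hbz x hx, mul_zero])
    (by fun_prop)
    (fun t x => by
      nlinarith [mul_le_mul_of_nonneg_left (hbr x) (hw₂0 t),
        mul_le_mul_of_nonneg_right (hw₂p t) (sq_nonneg ‖x‖)])
    (by linarith)
    (by rw [intervalIntegral.integral_mul_const, hInt]; linarith)
  have hyc : ContinuousOn y (Icc 0 1) := fun t ht => (hy t ht).continuousAt.continuousWithinAt
  have hconst : ∀ t ∈ Icc (1 / 2 : ℝ) 1, ‖y t‖ ^ 2 = ‖y (1 / 2)‖ ^ 2 := by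
    have hsub : Icc (1 / 2 : ℝ) 1 ⊆ Icc 0 1 := Icc_subset_Icc_left (by norm_num)
    refine constant_of_has_deriv_right_zero (f := fun t => ‖y t‖ ^ 2)
      ((hyc.mono hsub).norm.pow 2) fun t ht => ?_
    have h1 := (hy t (hsub ⟨ht.1, ht.2.le⟩)).norm_sq
    have h2 : (2 : ℝ) * inner ℝ (y t) (Complex.I • ((T * w₁ t) • g (T * τ t) (y t) -
        s • w₂ t • c (y t) • y t)) = 0 := by
      rw [hw₁r t ⟨ht.1, ht.2.le⟩, mul_zero, zero_smul, zero_sub, smul_smul, smul_smul,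
        ← neg_smul, ← Complex.coe_smul]
      change (2 : ℝ) * (inner ℂ _ _).re = 0
      rw [smul_smul, inner_smul_right, inner_self_eq_norm_sq_to_K]
      simp [← Complex.ofReal_pow]
    rw [h2] at h1
    exact h1.hasDerivWithinAt
  have hball : ‖y (1 / 2)‖ < r := by
    obtain ⟨t, ht, hne⟩ : ∃ t ∈ Icc (0 : ℝ) 1, w₂ t * b (y t) ≠ 0 := by
      by_contra! hcon
      rw [intervalIntegral.integral_congr (g := fun _ => (0 : ℝ)) fun t ht => hcon t
        (by rwa [uIcc_of_le zero_le_one] at ht)] at hpos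
      simp at hpos
    have ht2 : 1 / 2 ≤ t := by
      by_contra! hlt
      exact hne (by rw [hw₂l t ⟨ht.1, hlt.le⟩, zero_mul])
    have hlt : ‖y t‖ < r := by
      by_contra! hle
      exact hne (by rw [hbz _ hle, mul_zero])
    have := hconst t ⟨ht2, ht.2⟩
    rwa [← (pow_left_inj₀ (norm_nonneg _) (norm_nonneg _) two_ne_zero).1 this]
  refine ⟨y 0, y (1 / 2), ?_, hball, fun x hx0 hx => ?_⟩
  · rw [hy01]
    exact lt_of_pow_lt_pow_left₀ 2 hr.le
      ((hconst 1 ⟨by norm_num, le_rfl⟩).trans_lt (pow_lt_pow_left₀ hball (norm_nonneg _) two_ne_zero))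
  · have hsub : Icc (0 : ℝ) (1 / 2) ⊆ Icc 0 1 := Icc_subset_Icc_right (by norm_num)
    have hdx : ∀ t ∈ Icc (0 : ℝ) (1 / 2), HasDerivAt (fun t => x (T * τ t))
        (Complex.I • (T * w₁ t) • g (T * τ t) (x (T * τ t))) t := fun t ht => by
      have h1 := (hx _ (hτm t)).scomp t ((hτ t).const_mul T)
      rw [← hw₁l t ht] at h1
      rw [smul_comm]
      exact h1
    have hdy : ∀ t ∈ Icc (0 : ℝ) (1 / 2), HasDerivAt y
        (Complex.I • (T * w₁ t) • g (T * τ t) (y t)) t := fun t ht => by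
      have h1 := hy t (hsub ht)
      rw [hw₂l t ht, zero_smul, smul_zero, sub_zero] at h1
      exact h1
    have hv : ∀ t, LipschitzWith (Real.pi.toNNReal * L)
        (fun z => Complex.I • (T * w₁ t) • g (T * τ t) z) := fun t => by
      refine LipschitzWith.of_dist_le_mul fun z z' => ?_
      rw [dist_eq_norm, ← smul_sub, ← smul_sub, norm_smul, norm_smul, Complex.norm_I, one_mul,
        Real.norm_eq_abs, NNReal.coe_mul, Real.coe_toNNReal _ hpi.le, mul_assoc, ← dist_eq_norm]
      exact mul_le_mul (hTw t) ((hL _).dist_le_mul _ _) dist_nonneg hpi.le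
    have key := ODE_solution_unique (a := 0) (b := 1 / 2) hv
      (fun t ht => (hdx t ht).continuousAt.continuousWithinAt)
      (fun t ht => (hdx t ⟨ht.1, ht.2.le⟩).hasDerivWithinAt)
      (fun t ht => (hdy t ht).continuousAt.continuousWithinAt)
      (fun t ht => (hdy t ⟨ht.1, ht.2.le⟩).hasDerivWithinAt)
      (by simp only [hτ0, mul_zero, hx0])
    have := key (right_mem_Icc.2 (by norm_num : (0 : ℝ) ≤ 1 / 2))
    simpa only [hτh, mul_one] using this

end NonDisplacement

section HamiltonianVectorField

variable {n : ℕ}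

/-- The point `(q, p)` of phase space with `q = im w` and `p = re w`. -/
noncomputable def phaseOfComplex (n : ℕ) : EuclideanSpace ℂ (Fin n) →L[ℝ] Phase n :=
  LinearMap.toContinuousLinearMap
    { toFun := fun w => (WithLp.toLp 2 fun j => (w j).im, WithLp.toLp 2 fun j => (w j).re)
      map_add' := fun v w => by ext j <;> simp
      map_smul' := fun a w => by ext j <;> simp }

/-- The complex vector `p + iq` attached to the point `(q, p)` of phase space. -/
noncomputable def complexOfPhase (n : ℕ) : Phase n →L[ℝ] EuclideanSpace ℂ (Fin n) :=
  LinearMap.toContinuousLinearMap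
    { toFun := fun x => WithLp.toLp 2 fun j => ⟨x.2 j, x.1 j⟩
      map_add' := fun v w => by ext j; apply Complex.ext <;> simp
      map_smul' := fun a w => by ext j; apply Complex.ext <;> simp }

theorem phaseOfComplex_complexOfPhase (x : Phase n) : phaseOfComplex n (complexOfPhase n x) = x := by
  ext j <;> simp [phaseOfComplex, complexOfPhase]

theorem complexOfPhase_phaseOfComplex (w : EuclideanSpace ℂ (Fin n)) :
    complexOfPhase n (phaseOfComplex n w) = w := by
  ext j; apply Complex.ext <;> simp [phaseOfComplex, complexOfPhase]

theorem norm_phaseOfComplex_le (w : EuclideanSpace ℂ (Fin n)) : ‖phaseOfComplex n w‖ ≤ ‖w‖ := by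
  have key : ∀ f : ℂ → ℝ, (∀ z, |f z| ≤ ‖z‖) →
      ‖(WithLp.toLp 2 fun j => f (w j) : EuclideanSpace ℝ (Fin n))‖ ≤ ‖w‖ := fun f hf => by
    rw [EuclideanSpace.norm_eq, EuclideanSpace.norm_eq]
    exact Real.sqrt_le_sqrt (Finset.sum_le_sum fun j _ =>
      pow_le_pow_left₀ (norm_nonneg _) (hf (w j)) 2)
  exact max_le (key _ Complex.abs_im_le_norm) (key _ Complex.abs_re_le_norm)

theorem re_inner_complexOfPhase (a : Phase n) (u : EuclideanSpace ℂ (Fin n)) :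
    (inner ℂ (-(Complex.I • complexOfPhase n a)) u).re =
      inner ℝ a.1 (phaseOfComplex n u).2 - inner ℝ a.2 (phaseOfComplex n u).1 := by
  simp only [PiLp.inner_apply, Complex.re_sum, ← Finset.sum_sub_distrib]
  refine Finset.sum_congr rfl fun j _ => ?_
  simp [phaseOfComplex, complexOfPhase]

/-- The vector dual, under the symplectic form, to the spatial part of a covector. -/
noncomputable def symplecticDual (D : ℝ × Phase n →L[ℝ] ℝ) : Phase n :=
  ((InnerProductSpace.toDual ℝ _).symm ((D.comp (.inr ℝ ℝ (Phase n))).comp (.inr ℝ _ _)),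
    -(InnerProductSpace.toDual ℝ _).symm ((D.comp (.inr ℝ ℝ (Phase n))).comp (.inl ℝ _ _)))

theorem inner_symplecticDual (D : ℝ × Phase n →L[ℝ] ℝ) (v : Phase n) :
    inner ℝ (symplecticDual D).1 v.2 - inner ℝ (symplecticDual D).2 v.1 = D (0, v) := by
  simp only [symplecticDual, inner_neg_left, InnerProductSpace.toDual_symm_apply,
    ContinuousLinearMap.comp_apply, ContinuousLinearMap.inr_apply, ContinuousLinearMap.inl_apply,
    sub_neg_eq_add, ← map_add]
  simp

theorem norm_symplecticDual_le (D : ℝ × Phase n →L[ℝ] ℝ) : ‖symplecticDual D‖ ≤ ‖D‖ := by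
  refine max_le ?_ ?_
  · rw [symplecticDual, LinearIsometryEquiv.norm_map]
    refine ContinuousLinearMap.opNorm_le_bound _ (norm_nonneg _) fun u => ?_
    refine (D.le_opNorm _).trans (mul_le_mul_of_nonneg_left ?_ (norm_nonneg _))
    simp [Prod.norm_def]
  · rw [symplecticDual, norm_neg, LinearIsometryEquiv.norm_map]
    refine ContinuousLinearMap.opNorm_le_bound _ (norm_nonneg _) fun u => ?_
    refine (D.le_opNorm _).trans (mul_le_mul_of_nonneg_left ?_ (norm_nonneg _))
    simp [Prod.norm_def]

theorem lipschitzWith_symplecticDual : LipschitzWith 1 (symplecticDual (n := n)) := by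
  refine LipschitzWith.of_dist_le_mul fun D D' => ?_
  have h : symplecticDual D - symplecticDual D' = symplecticDual (D - D') := by
    simp only [symplecticDual, ContinuousLinearMap.sub_comp, map_sub, Prod.mk_sub_mk, neg_sub,
      neg_sub_neg]
  rw [dist_eq_norm, dist_eq_norm, h, NNReal.coe_one, one_mul]
  exact norm_symplecticDual_le _

theorem hamVF_eq_symplecticDual {H : ℝ × Phase n → ℝ} (hH : Differentiable ℝ H) (t : ℝ)
    (x : Phase n) : hamVF H t x = symplecticDual (fderiv ℝ H (t, x)) := by
  have h0 : HasFDerivAt (fun y => H (t, y)) ((fderiv ℝ H (t, x)).comp (.inr ℝ ℝ (Phase n))) x :=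
    (hH (t, x)).hasFDerivAt.comp (f := fun y => (t, y)) x (hasFDerivAt_prodMk_right t x)
  have hp : HasFDerivAt (fun p => H (t, (x.1, p)))
      (((fderiv ℝ H (t, x)).comp (.inr ℝ ℝ (Phase n))).comp (.inr ℝ _ _)) x.2 :=
    h0.comp (f := fun p => (x.1, p)) x.2 (hasFDerivAt_prodMk_right x.1 x.2)
  have hq : HasFDerivAt (fun q => H (t, (q, x.2)))
      (((fderiv ℝ H (t, x)).comp (.inr ℝ ℝ (Phase n))).comp (.inl ℝ _ _)) x.1 :=
    h0.comp (f := fun q => (q, x.2)) x.1 (hasFDerivAt_prodMk_left x.1 x.2)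
  rw [hamVF, symplecticDual, gradient, gradient, hp.fderiv, hq.fderiv]

theorem hamVF_congr {H G : ℝ × Phase n → ℝ} {t k : ℝ} {x : Phase n}
    (h : ∀ᶠ y in 𝓝 x, G (t, y) = H (t, y) - k) : hamVF G t x = hamVF H t x := by
  have hp : Tendsto (fun p => (x.1, p)) (𝓝 x.2) (𝓝 x) :=
    (Continuous.prodMk_right x.1).tendsto x.2
  have hq : Tendsto (fun q => (q, x.2)) (𝓝 x.1) (𝓝 x) :=
    (Continuous.prodMk_left x.2).tendsto x.1
  have ep : (fun p => G (t, (x.1, p))) =ᶠ[𝓝 x.2] fun p => H (t, (x.1, p)) - k := hp.eventually h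
  have eq : (fun q => G (t, (q, x.2))) =ᶠ[𝓝 x.1] fun q => H (t, (q, x.2)) - k := hq.eventually h
  simp only [hamVF, gradient]
  rw [ep.fderiv_eq, eq.fderiv_eq, fderiv_sub_const, fderiv_sub_const]

theorem exists_bound_hamVF {G : ℝ × Phase n → ℝ} (hG : ContDiff ℝ 2 G)
    (hs : HasCompactSupport G) :
    ∃ L : NNReal, (∀ t x, ‖hamVF G t x‖ ≤ L) ∧ (∀ t, LipschitzWith L (hamVF G t)) ∧
      (Continuous fun p : ℝ × Phase n => hamVF G p.1 p.2) ∧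
      ∀ t x u, |G (t, x + u) - G (t, x) - (inner ℝ (hamVF G t x).1 u.2
        - inner ℝ (hamVF G t x).2 u.1)| ≤ L * ‖u‖ ^ 2 := by
  obtain ⟨L, hL, hLip, hT⟩ := hG.taylor_bound_of_hasCompactSupport hs
  have e := hamVF_eq_symplecticDual (hG.differentiable (by norm_num))
  refine ⟨L, fun t x => ?_, fun t => ?_, ?_, fun t x u => ?_⟩
  · rw [e]; exact (norm_symplecticDual_le _).trans (hL _)
  · have h1 : LipschitzWith (1 * (L * 1)) (hamVF G t) := by
      rw [funext (e t)]
      exact lipschitzWith_symplecticDual.comp (hLip.comp (LipschitzWith.prodMk_left t))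
    simpa using h1
  · simp only [e]
    exact lipschitzWith_symplecticDual.continuous.comp hLip.continuous
  · rw [e, inner_symplecticDual]
    have := hT (t, x) (0, u)
    simpa [Prod.norm_def] using this

theorem exists_tamedHam_of_hasCompactSupport {G : ℝ × Phase n → ℝ} (hG : ContDiff ℝ 2 G)
    (hs : HasCompactSupport G) (x₀ : Phase n) :
    ∃ (C l : ℝ) (L : NNReal),
      TamedHam (fun t w => G (t, x₀ + phaseOfComplex n w))
        (fun t w => -(Complex.I • complexOfPhase n (hamVF G t (x₀ + phaseOfComplex n w)))) C l ∧
      ∀ t, LipschitzWith L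
        fun w => -(Complex.I • complexOfPhase n (hamVF G t (x₀ + phaseOfComplex n w))) := by
  obtain ⟨L, hL, hLip, hc, hT⟩ := exists_bound_hamVF hG hs
  refine ⟨‖complexOfPhase n‖ * L, L, ‖complexOfPhase n‖₊ * L, ⟨?_, ?_, fun t x => ?_, ?_⟩, ?_⟩
  · exact hG.continuous.comp (continuous_fst.prodMk
      (continuous_const.add ((phaseOfComplex n).continuous.comp continuous_snd)))
  · have h1 : Continuous fun p : ℝ × EuclideanSpace ℂ (Fin n) =>
        complexOfPhase n (hamVF G p.1 (x₀ + phaseOfComplex n p.2)) :=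
      (complexOfPhase n).continuous.comp (hc.comp (continuous_fst.prodMk
        (continuous_const.add ((phaseOfComplex n).continuous.comp continuous_snd))))
    exact (h1.const_smul Complex.I).neg
  · rw [norm_neg, norm_smul, Complex.norm_I, one_mul]
    exact ((complexOfPhase n).le_opNorm _).trans
      (mul_le_mul_of_nonneg_left (hL _ _) (norm_nonneg _))
  · intro t x u
    rw [re_inner_complexOfPhase, map_add, ← add_assoc]
    exact (hT _ _ _).trans (mul_le_mul_of_nonneg_left
      (pow_le_pow_left₀ (norm_nonneg _) (norm_phaseOfComplex_le u) 2) L.2)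
  · intro t
    refine LipschitzWith.of_dist_le_mul fun v w => ?_
    rw [dist_neg_neg, dist_eq_norm, ← smul_sub, norm_smul, Complex.norm_I, one_mul, ← map_sub,
      NNReal.coe_mul, coe_nnnorm, mul_assoc]
    refine ((complexOfPhase n).le_opNorm _).trans (mul_le_mul_of_nonneg_left ?_ (norm_nonneg _))
    rw [← dist_eq_norm]
    refine ((hLip t).dist_le_mul _ _).trans (mul_le_mul_of_nonneg_left ?_ L.2)
    rw [dist_add_left, dist_eq_norm, dist_eq_norm, ← map_sub]
    exact norm_phaseOfComplex_le _

/-- Multiplying by a cutoff which is `1` on `[0,1] × closedBall x₀ ρ`. -/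
theorem exists_cutoff (x₀ : Phase n) {ρ ρ' : ℝ} (hρ : 0 < ρ) (hρ' : ρ < ρ') :
    ∃ χ : ℝ × Phase n → ℝ, ContDiff ℝ 2 χ ∧ HasCompactSupport χ ∧ (∀ z, 0 ≤ χ z) ∧ (∀ z, χ z ≤ 1) ∧
      (∀ t ∈ Icc (0 : ℝ) 1, ∀ x ∈ closedBall x₀ ρ, χ (t, x) = 1) ∧
      ∀ t, ∀ x ∉ ball x₀ ρ', χ (t, x) = 0 := by
  let χ₁ : ContDiffBump (1 / 2 : ℝ) := ⟨1, 2, one_pos, one_lt_two⟩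
  let χ₂ : ContDiffBump x₀ := ⟨ρ, ρ', hρ, hρ'⟩
  refine ⟨fun z => χ₁ z.1 * χ₂ z.2, ?_, ?_, fun z => mul_nonneg χ₁.nonneg χ₂.nonneg,
    fun z => mul_le_one₀ χ₁.le_one χ₂.nonneg χ₂.le_one, fun t ht x hx => ?_, fun t x hx => ?_⟩
  · exact (χ₁.contDiff.comp contDiff_fst).mul (χ₂.contDiff.comp contDiff_snd)
  · refine HasCompactSupport.intro (χ₁.hasCompactSupport.prod χ₂.hasCompactSupport) ?_
    rintro ⟨t, x⟩ h
    rw [mem_prod, not_and_or] at h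
    rcases h with h | h
    · simp only [image_eq_zero_of_notMem_tsupport h, zero_mul]
    · simp only [image_eq_zero_of_notMem_tsupport h, mul_zero]
  · have h1 : χ₁ t = 1 := χ₁.one_of_mem_closedBall (by
      rw [mem_closedBall, Real.dist_eq, abs_le]
      change -(1 : ℝ) ≤ _ ∧ _ ≤ (1 : ℝ)
      constructor <;> linarith [ht.1, ht.2])
    have h2 : χ₂ x = 1 := χ₂.one_of_mem_closedBall hx
    simp only [h1, h2, mul_one]
  · have h2 : χ₂ x = 0 := χ₂.zero_of_le_dist (by simpa using hx)
    simp only [h2, mul_zero]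

theorem exists_lipschitzWith_hamVF {H : ℝ × Phase n → ℝ} (hH : ContDiff ℝ 2 H) {K : Set (Phase n)}
    (hK : Bornology.IsBounded K)
    (hsupp : ∀ t ∈ Icc (0 : ℝ) 1, (Function.support fun x => H (t, x)) ⊆ K) :
    ∃ L : NNReal, ∀ t ∈ Icc (0 : ℝ) 1, LipschitzWith L (hamVF H t) := by
  obtain ⟨ρ, hρ⟩ := hK.subset_closedBall (0 : Phase n)
  obtain ⟨χ, hχ, hχs, -, -, hχ1, -⟩ := exists_cutoff (0 : Phase n) (ρ := max ρ 1)
    (lt_max_of_lt_right one_pos) (lt_add_one _)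
  obtain ⟨L, -, hL, -⟩ := exists_bound_hamVF (G := fun z => χ z * H z) (hχ.mul hH) hχs.mul_right
  refine ⟨L, fun t ht => ?_⟩
  have : hamVF H t = hamVF (fun z => χ z * H z) t := funext fun x => by
    refine (hamVF_congr (k := 0) (Eventually.of_forall fun y => ?_)).symm
    rw [sub_zero]
    by_cases hy : H (t, y) = 0
    · rw [hy, mul_zero]
    · rw [hχ1 t ht y (closedBall_subset_closedBall (le_max_left _ _) (hρ (hsupp t ht hy))), one_mul]
  rw [this]
  exact hL t

end HamiltonianVectorField

section Locality

variable {n : ℕ}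

/-- A Hamiltonian flow whose generator has small oscillation near `x₀` does not displace the ball
around `x₀`, as long as the trajectories issued from that ball stay near `x₀`. -/
theorem IsHamFlow.exists_mem_ball_of_small_oscillation {H : ℝ × Phase n → ℝ}
    {φ : ℝ × Phase n → Phase n} (hφ : IsHamFlow H φ) (hH : ContDiff ℝ 2 H) {x₀ : Phase n}
    {η ε r T : ℝ} (hη : 0 < η) (hr : 0 < r) (hεr : 2 * (Real.pi * ε) < r ^ 2 / 4)
    (hT : T ∈ Ioc (0 : ℝ) 1)
    (hosc : ∀ t ∈ Icc (0 : ℝ) 1, ∀ x ∈ ball x₀ (3 * η), |H (t, x) - H (t, x₀)| ≤ ε)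
    (htube : ∀ y ∈ ball x₀ r, ∀ s ∈ Icc (0 : ℝ) T, φ (s, y) ∈ ball x₀ (2 * η)) :
    ∃ y ∈ ball x₀ r, φ (T, y) ∈ ball x₀ r := by
  obtain ⟨χ, hχ, hχs, hχ0, hχ1, hχone, hχzero⟩ := exists_cutoff x₀ (ρ := 2 * η) (ρ' := 3 * η)
    (by positivity) (by linarith)
  let G : ℝ × Phase n → ℝ := fun z => χ z * (H z - H (z.1, x₀))
  have hG : ContDiff ℝ 2 G := hχ.mul (hH.sub (hH.comp (contDiff_fst.prodMk contDiff_const)))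
  obtain ⟨C, l, L, hTam, hLip⟩ := exists_tamedHam_of_hasCompactSupport hG hχs.mul_right x₀
  have hε0 : 0 ≤ ε := (abs_nonneg _).trans
    (hosc 0 ⟨le_rfl, zero_le_one⟩ x₀ (mem_ball_self (by positivity)))
  have hGε : ∀ t ∈ Icc (0 : ℝ) 1, ∀ w : EuclideanSpace ℂ (Fin n),
      |G (t, x₀ + phaseOfComplex n w)| ≤ ε := fun t ht w => by
    by_cases hx : x₀ + phaseOfComplex n w ∈ ball x₀ (3 * η)
    · simp only [G, abs_mul, abs_of_nonneg (hχ0 _)]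
      exact (mul_le_of_le_one_left (abs_nonneg _) (hχ1 _)).trans (hosc t ht _ hx)
    · simpa only [G, hχzero t _ hx, zero_mul, abs_zero] using hε0
  have hvf : ∀ t ∈ Icc (0 : ℝ) 1, ∀ x ∈ ball x₀ (2 * η), hamVF G t x = hamVF H t x :=
    fun t ht x hx => by
      refine hamVF_congr (k := H (t, x₀)) ?_
      filter_upwards [isOpen_ball.mem_nhds hx] with y hy
      simp only [G, hχone t ht y (ball_subset_closedBall hy), one_mul]
  obtain ⟨p, q, hp, hq, hpq⟩ := hTam.exists_trajectory_returning hLip hGε hr hεr hT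
  have hmem : ∀ w : EuclideanSpace ℂ (Fin n), ‖w‖ < r → x₀ + phaseOfComplex n w ∈ ball x₀ r :=
    fun w hw => by
      rw [mem_ball, dist_eq_norm, add_sub_cancel_left]
      exact (norm_phaseOfComplex_le w).trans_lt hw
  set y := x₀ + phaseOfComplex n p with hy
  refine ⟨y, hmem p hp, ?_⟩
  have hback : ∀ x, x₀ + phaseOfComplex n (complexOfPhase n (x - x₀)) = x := fun x => by
    rw [phaseOfComplex_complexOfPhase, add_sub_cancel]
  have key := hpq (fun s => complexOfPhase n (φ (s, y) - x₀))
    (by simp only [hφ.1, hy, add_sub_cancel_left, complexOfPhase_phaseOfComplex])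
    (fun t ht => by
      have ht1 : t ∈ Icc (0 : ℝ) 1 := ⟨ht.1, ht.2.trans hT.2⟩
      have h1 := (complexOfPhase n).hasFDerivAt.comp_hasDerivAt t
        ((hφ.2 y t ht1).sub_const x₀)
      simp only [hback]
      rw [hvf t ht1 _ (htube y (hmem p hp) t ht), smul_neg, smul_smul, Complex.I_mul_I, neg_one_smul,
        neg_neg]
      exact h1)
  rw [← hback (φ (T, y)), key]
  exact hmem q hq

theorem IsHamFlow.exists_dist_le {H : ℝ × Phase n → ℝ} {φ : ℝ × Phase n → Phase n}
    (hφ : IsHamFlow H φ) (hH : ContDiff ℝ 2 H) {K : Set (Phase n)} (hK : Bornology.IsBounded K)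
    (hsupp : ∀ t ∈ Icc (0 : ℝ) 1, (Function.support fun x => H (t, x)) ⊆ K) :
    ∃ A > 0, ∀ t ∈ Icc (0 : ℝ) 1, ∀ x y, dist (φ (t, x)) (φ (t, y)) ≤ A * dist x y := by
  obtain ⟨L, hL⟩ := exists_lipschitzWith_hamVF hH hK hsupp
  refine ⟨Real.exp L, Real.exp_pos _, fun t ht x y => ?_⟩
  have h := dist_le_of_trajectories_ODE_of_mem (v := hamVF H) (K := L) (s := fun _ => univ)
    (f := fun t => φ (t, x)) (g := fun t => φ (t, y)) (a := 0) (b := 1) (δ := dist x y)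
    (fun t ht => (hL t ⟨ht.1, ht.2.le⟩).lipschitzOnWith)
    (fun t ht => (hφ.2 x t ht).continuousAt.continuousWithinAt)
    (fun t ht => (hφ.2 x t ⟨ht.1, ht.2.le⟩).hasDerivWithinAt) (fun _ _ => mem_univ _)
    (fun t ht => (hφ.2 y t ht).continuousAt.continuousWithinAt)
    (fun t ht => (hφ.2 y t ⟨ht.1, ht.2.le⟩).hasDerivWithinAt) (fun _ _ => mem_univ _)
    (by simp only [hφ.1]; exact le_rfl) t ht
  refine h.trans ?_
  rw [mul_comm]
  refine mul_le_mul_of_nonneg_right (Real.exp_le_exp.2 ?_) dist_nonneg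
  rw [sub_zero]
  exact mul_le_of_le_one_right L.2 ht.2

/-- The first time at which a continuous function reaches a given height. -/
theorem exists_first_hitting_time {f : ℝ → ℝ} (hf : ContinuousOn f (Icc 0 1)) (h0 : f 0 = 0)
    {t η : ℝ} (ht : t ∈ Icc (0 : ℝ) 1) (hη : 0 < η) (hηt : η ≤ f t) :
    ∃ T ∈ Ioc (0 : ℝ) 1, f T = η ∧ ∀ s ∈ Icc (0 : ℝ) T, f s ≤ η := by
  have hcl : IsCompact (Icc (0 : ℝ) 1 ∩ f ⁻¹' Ici η) :=
    isCompact_Icc.of_isClosed_subset (hf.preimage_isClosed_of_isClosed isClosed_Icc isClosed_Ici)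
      inter_subset_left
  obtain ⟨T, ⟨hT, hTη⟩, hmin⟩ := hcl.exists_isLeast ⟨t, ht, hηt⟩
  have hTη' : η ≤ f T := hTη
  have hlt : ∀ s ∈ Ico (0 : ℝ) T, f s < η := fun s hs => by
    by_contra! hle
    exact absurd (hmin ⟨⟨hs.1, hs.2.le.trans hT.2⟩, hle⟩) (not_le.2 hs.2)
  obtain ⟨s, hs, hfs⟩ : η ∈ f '' Icc 0 T :=
    intermediate_value_Icc hT.1 (hf.mono (Icc_subset_Icc_right hT.2)) ⟨by rw [h0]; exact hη.le, hTη'⟩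
  have hsT : s = T := by
    by_contra hne
    exact absurd hfs (hlt s ⟨hs.1, lt_of_le_of_ne hs.2 hne⟩).ne
  rw [hsT] at hfs
  refine ⟨T, ⟨lt_of_le_of_ne hT.1 fun h => ?_, hT.2⟩, hfs, fun s hs => ?_⟩
  · rw [← h, h0] at hfs
    exact hη.ne hfs
  · rcases eq_or_lt_of_le hs.2 with rfl | h
    · exact hfs.le
    · exact (hlt s ⟨hs.1, h⟩).le

end Locality

end LocalityAux

/-- The easy direction of the C⁰-locality theorem, instantiated on standard
`(ℝ^{2n}, ω₀)`: if the limit Hamiltonian depends only on `t` on an open set `U`,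
then the limit flow fixes every point of `U`. -/
theorem locality_easy_direction (n : ℕ) (hn : 1 ≤ n)
    (U : Set (Phase n)) (hU : IsOpen U)
    (H : ℕ → ℝ × Phase n → ℝ) (Hlim : ℝ × Phase n → ℝ)
    (φ : ℕ → ℝ × Phase n → Phase n) (lam : ℝ × Phase n → Phase n)
    (hsmooth : ∀ i, ContDiff ℝ (⊤ : ℕ∞) (H i))
    (K : Set (Phase n)) (hK : IsCompact K)
    (hsupp : ∀ i, ∀ t ∈ Set.Icc (0:ℝ) 1,
      (Function.support fun x => H i (t, x)) ⊆ K)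
    (hflow : ∀ i, IsHamFlow (H i) (φ i))
    (hHlim : Continuous Hlim)
    (hHconv : ∀ ε > 0, ∃ N, ∀ i ≥ N, ∀ t ∈ Set.Icc (0:ℝ) 1, ∀ x : Phase n,
      |H i (t, x) - Hlim (t, x)| < ε)
    (hφconv : ∀ ε > 0, ∃ N, ∀ i ≥ N, ∀ t ∈ Set.Icc (0:ℝ) 1, ∀ x : Phase n,
      dist (φ i (t, x)) (lam (t, x)) < ε)
    (c : ℝ → ℝ) (hc : ContinuousOn c (Set.Icc (0:ℝ) 1))
    (hHc : ∀ t ∈ Set.Icc (0:ℝ) 1, ∀ x ∈ U, Hlim (t, x) = c t) :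
    ∀ t ∈ Set.Icc (0:ℝ) 1, ∀ x ∈ U, lam (t, x) = x := by
  intro t₁ ht₁ x₀ hx₀
  by_contra hne
  have hsm : ∀ i, ContDiff ℝ 2 (H i) := fun i => (hsmooth i).of_le (WithTop.coe_le_coe.2 (le_top : (2 : ℕ∞) ≤ ⊤))
  have h01 : (0 : ℝ) ∈ Set.Icc (0 : ℝ) 1 := ⟨le_rfl, zero_le_one⟩
  obtain ⟨ρ₀, hρ₀, hball⟩ := Metric.isOpen_iff.1 hU x₀ hx₀
  have hcont : ContinuousOn (fun t => lam (t, x₀)) (Set.Icc 0 1) := by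
    refine TendstoUniformlyOn.continuousOn (F := fun i t => φ i (t, x₀)) (p := Filter.atTop)
      (Metric.tendstoUniformlyOn_iff.2 fun ε hε => ?_) (Filter.Frequently.of_forall fun i t ht =>
        ((hflow i).2 x₀ t ht).continuousAt.continuousWithinAt)
    obtain ⟨N, hN⟩ := hφconv ε hε
    filter_upwards [Filter.eventually_ge_atTop N] with i hi t ht
    rw [dist_comm]
    exact hN i hi t ht x₀
  have hlam0 : lam (0, x₀) = x₀ := by
    refine (eq_of_forall_dist_le fun ε hε => ?_).symm
    obtain ⟨N, hN⟩ := hφconv ε hε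
    have := hN N le_rfl 0 h01 x₀
    rw [(hflow N).1] at this
    exact this.le
  let η := min (dist (lam (t₁, x₀)) x₀) (ρ₀ / 4)
  have hη : 0 < η := lt_min (dist_pos.2 hne) (by positivity)
  have hη4 : η ≤ ρ₀ / 4 := min_le_right _ _
  obtain ⟨T, hT, hTη, hle⟩ := exists_first_hitting_time
    (f := fun t => dist (lam (t, x₀)) x₀) ((continuous_id.dist continuous_const).comp_continuousOn hcont)
    (by simp only [hlam0, dist_self]) ht₁ hη (min_le_left _ _)
  have hT1 : T ∈ Set.Icc (0 : ℝ) 1 := ⟨hT.1.le, hT.2⟩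
  obtain ⟨N, hN⟩ := hφconv (η / 8) (by positivity)
  obtain ⟨A, hA, hdist⟩ := (hflow N).exists_dist_le (hsm N) hK.isBounded (hsupp N)
  let r := min (η / 8) (η / 8 / A)
  have hr : 0 < r := lt_min (by positivity) (by positivity)
  have hclose : ∀ i ≥ N, ∀ y ∈ Metric.ball x₀ r, ∀ s ∈ Set.Icc (0 : ℝ) 1,
      dist (φ i (s, y)) (lam (s, x₀)) < η / 2 := fun i hi y hy s hs => by
    have h1 := hN i hi s hs y
    have h2 := hN N le_rfl s hs y
    have h3 := hN N le_rfl s hs x₀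
    have h4 : dist (φ N (s, y)) (φ N (s, x₀)) ≤ η / 8 := by
      refine (hdist s hs y x₀).trans ?_
      have : dist y x₀ ≤ η / 8 / A := (Metric.mem_ball.1 hy).le.trans (min_le_right _ _)
      rw [le_div_iff₀ hA] at this
      linarith
    have h5 := dist_triangle4 (φ N (s, y)) (φ N (s, x₀)) (lam (s, x₀)) (lam (s, x₀))
    have h6 := dist_triangle4 (φ i (s, y)) (lam (s, y)) (φ N (s, y)) (lam (s, x₀))
    rw [dist_self] at h5
    rw [dist_comm (lam (s, y))] at h6
    linarith
  obtain ⟨M, hM⟩ := hHconv (r ^ 2 / (32 * Real.pi)) (by positivity)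
  let i := max N M
  obtain ⟨y, hy, hyT⟩ := (hflow i).exists_mem_ball_of_small_oscillation (hsm i) (x₀ := x₀) hη hr
    (ε := r ^ 2 / (16 * Real.pi)) (by
      have hpi := Real.pi_pos
      rw [show 2 * (Real.pi * (r ^ 2 / (16 * Real.pi))) = r ^ 2 / 8 by field_simp; norm_num]
      nlinarith [pow_pos hr 2]) hT
    (fun t ht x hx => by
      have hxU : x ∈ U := hball (Metric.ball_subset_ball (by linarith) hx)
      have h1 := hM i (le_max_right _ _) t ht x
      have h2 := hM i (le_max_right _ _) t ht x₀
      rw [hHc t ht x hxU] at h1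
      rw [hHc t ht x₀ hx₀] at h2
      rw [show r ^ 2 / (16 * Real.pi) = r ^ 2 / (32 * Real.pi) + r ^ 2 / (32 * Real.pi) by ring]
      rw [abs_lt] at h1 h2
      rw [abs_le]
      constructor <;> linarith [h1.1, h1.2, h2.1, h2.2])
    (fun y hy s hs => by
      have h1 := hclose i (le_max_left _ _) y hy s ⟨hs.1, hs.2.trans hT.2⟩
      have h2 := hle s hs
      have h3 := dist_triangle (φ i (s, y)) (lam (s, x₀)) x₀
      rw [Metric.mem_ball]
      linarith)
  have h1 := hclose i (le_max_left _ _) y hy T hT1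
  have h2 := dist_triangle_left (lam (T, x₀)) x₀ (φ i (T, y))
  have h3 : dist (φ i (T, y)) x₀ < η / 8 := (Metric.mem_ball.1 hyT).trans_le (min_le_left _ _)
  linarith
end

section
/- Let n ≥ 1, let U ⊆ ℝⁿ be open, and let h : [0,1] × U → ℝ be a bounded continuous function. Suppose that for some t₀ ∈ [0,1] the function h(t₀,·) takes both a strictly positive and a strictly negative value on U. Then there exists a smooth function f : ℝ × ℝⁿ → ℝ whose support is a compact subset of (0,1) × U, such that ∫_U f(θ,y) dy = 0 for every θ ∈ ℝ, and ∫_0^1 ∫_U f(θ,y) h(θ,y) dy dθ > 0. (This is the key analytic step in the proof that the Calabi current h dθ is not closed on U when h is not constant in the space variable.) -/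
open MeasureTheory

/-- A point of `(0, 1) × U` at which `h` is positive is the centre of a closed ball inside
`(0, 1) × U` on which `h` is positive. -/
lemma exists_closedBall_prod_subset_pos {E : Type*} [PseudoMetricSpace E] {U : Set E}
    (hU : IsOpen U) {h : ℝ × E → ℝ} (hc : ContinuousOn h (Set.Ioo (0:ℝ) 1 ×ˢ U))
    {t : ℝ} (ht : t ∈ Set.Ioo (0:ℝ) 1) {y : E} (hy : y ∈ U) (hty : 0 < h (t, y)) :
    ∃ r > 0, ∀ s ∈ Metric.closedBall t r, ∀ z ∈ Metric.closedBall y r,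
      s ∈ Set.Ioo (0:ℝ) 1 ∧ z ∈ U ∧ 0 < h (s, z) := by
  have hS : IsOpen ((Set.Ioo (0:ℝ) 1 ×ˢ U) ∩ h ⁻¹' Set.Ioi 0) :=
    hc.isOpen_inter_preimage (isOpen_Ioo.prod hU) isOpen_Ioi
  obtain ⟨r, hr, hsub⟩ := Metric.nhds_basis_closedBall.mem_iff.1
    (hS.mem_nhds (show (t, y) ∈ _ from ⟨⟨ht, hy⟩, hty⟩))
  refine ⟨r, hr, fun s hs z hz => ?_⟩
  have hsz : (s, z) ∈ Metric.closedBall (t, y) r := by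
    rw [← closedBall_prod_same]
    exact ⟨hs, hz⟩
  obtain ⟨⟨h₁, h₂⟩, h₃⟩ := hsub hsz
  exact ⟨h₁, h₂, h₃⟩

/-- The strict signs of `h` at time `t₀` persist at some interior time. -/
lemma exists_mem_Ioo_pos_neg {E : Type*} [TopologicalSpace E] {U : Set E} {h : ℝ × E → ℝ}
    (hc : ContinuousOn h (Set.Icc (0:ℝ) 1 ×ˢ U)) {t₀ : ℝ} (ht₀ : t₀ ∈ Set.Icc (0:ℝ) 1)
    {p q : E} (hp : p ∈ U) (hq : q ∈ U) (hpos : 0 < h (t₀, p)) (hneg : h (t₀, q) < 0) :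
    ∃ t ∈ Set.Ioo (0:ℝ) 1, 0 < h (t, p) ∧ h (t, q) < 0 := by
  have slice : ∀ y ∈ U, ContinuousWithinAt (fun t => h (t, y)) (Set.Icc (0:ℝ) 1) t₀ :=
    fun y hy => (hc.comp (by fun_prop : ContinuousOn (fun t : ℝ => (t, y)) (Set.Icc 0 1))
      (fun t ht => ⟨ht, hy⟩)) t₀ ht₀
  have hmem : t₀ ∈ closure (Set.Ioo (0:ℝ) 1) := by
    rwa [closure_Ioo zero_ne_one]
  obtain ⟨t, ht, h₁, h₂⟩ := ((mem_closure_iff_frequently.1 hmem).and_eventually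
    ((eventually_nhdsWithin_iff.1 ((slice p hp).eventually (lt_mem_nhds hpos))).and
      (eventually_nhdsWithin_iff.1 ((slice q hq).eventually (gt_mem_nhds hneg))))).exists
  exact ⟨t, ht, h₁ (Set.Ioo_subset_Icc_self ht), h₂ (Set.Ioo_subset_Icc_self ht)⟩

/-- The key analytic step in showing that the Calabi current `h dθ` is not closed on `U`:
if a bounded continuous `h : [0,1] × U → ℝ` takes both signs in the space variable at
some time `t₀`, then there is a smooth test function `f`, compactly supported in
`(0,1) × U` and with zero fiberwise mass, pairing strictly positively with `h`. -/
theorem calabi_current_not_closed (n : ℕ) (hn : 1 ≤ n)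
    (U : Set (Fin n → ℝ)) (hU : IsOpen U)
    (h : ℝ × (Fin n → ℝ) → ℝ)
    (hc : ContinuousOn h (Set.Icc (0:ℝ) 1 ×ˢ U))
    (hb : ∃ C : ℝ, ∀ t ∈ Set.Icc (0:ℝ) 1, ∀ y ∈ U, |h (t, y)| ≤ C)
    (t₀ : ℝ) (ht₀ : t₀ ∈ Set.Icc (0:ℝ) 1)
    (hpos : ∃ y ∈ U, 0 < h (t₀, y)) (hneg : ∃ y ∈ U, h (t₀, y) < 0) :
    ∃ f : ℝ × (Fin n → ℝ) → ℝ, ContDiff ℝ (⊤ : ℕ∞) f ∧ HasCompactSupport f ∧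
      tsupport f ⊆ Set.Ioo (0:ℝ) 1 ×ˢ U ∧
      (∀ θ : ℝ, (∫ y in U, f (θ, y)) = 0) ∧
      0 < ∫ θ in (0:ℝ)..1, ∫ y in U, f (θ, y) * h (θ, y) := by
  obtain ⟨p, hp, hp0⟩ := hpos
  obtain ⟨q, hq, hq0⟩ := hneg
  obtain ⟨t, ht, htp, htq⟩ := exists_mem_Ioo_pos_neg hc ht₀ hp hq hp0 hq0
  have hco : ContinuousOn h (Set.Ioo (0:ℝ) 1 ×ˢ U) :=
    hc.mono (Set.prod_mono Set.Ioo_subset_Icc_self subset_rfl)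
  obtain ⟨r₁, hr₁, hball₁⟩ := exists_closedBall_prod_subset_pos hU hco ht hp htp
  obtain ⟨r₂, hr₂, hball₂⟩ := exists_closedBall_prod_subset_pos (h := fun x => -h x) hU
    hco.neg ht hq (neg_pos.2 htq)
  set r := min r₁ r₂
  have hr0 : 0 < r := lt_min hr₁ hr₂
  let χ : ContDiffBump t := ⟨r / 2, r, half_pos hr0, half_lt_self hr0⟩
  let φ : ContDiffBump p := ⟨r / 2, r, half_pos hr0, half_lt_self hr0⟩
  let ψ : ContDiffBump q := ⟨r / 2, r, half_pos hr0, half_lt_self hr0⟩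
  have hχ : ∀ s, χ s ≠ 0 → s ∈ Metric.closedBall t r := fun s hs =>
    Metric.ball_subset_closedBall (χ.support_eq ▸ Function.mem_support.2 hs)
  have hφ : ∀ y, φ.normed volume y ≠ 0 → y ∈ Metric.closedBall p r := fun y hy =>
    Metric.ball_subset_closedBall
      (φ.support_normed_eq (μ := volume) ▸ Function.mem_support.2 hy)
  have hψ : ∀ y, ψ.normed volume y ≠ 0 → y ∈ Metric.closedBall q r := fun y hy =>
    Metric.ball_subset_closedBall
      (ψ.support_normed_eq (μ := volume) ▸ Function.mem_support.2 hy)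
  replace hball₁ : ∀ s ∈ Metric.closedBall t r, ∀ y ∈ Metric.closedBall p r,
      s ∈ Set.Ioo (0:ℝ) 1 ∧ y ∈ U ∧ 0 < h (s, y) := fun s hs y hy =>
    hball₁ s (Metric.closedBall_subset_closedBall (min_le_left _ _) hs)
      y (Metric.closedBall_subset_closedBall (min_le_left _ _) hy)
  replace hball₂ : ∀ s ∈ Metric.closedBall t r, ∀ y ∈ Metric.closedBall q r,
      s ∈ Set.Ioo (0:ℝ) 1 ∧ y ∈ U ∧ 0 < -h (s, y) := fun s hs y hy =>
    hball₂ s (Metric.closedBall_subset_closedBall (min_le_right _ _) hs)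
      y (Metric.closedBall_subset_closedBall (min_le_right _ _) hy)
  let f : ℝ × (Fin n → ℝ) → ℝ := fun x => χ x.1 * (φ.normed volume x.2 - ψ.normed volume x.2)
  let K : Set (ℝ × (Fin n → ℝ)) :=
    Metric.closedBall t r ×ˢ (Metric.closedBall p r ∪ Metric.closedBall q r)
  have hK : IsCompact K :=
    (isCompact_closedBall t r).prod ((isCompact_closedBall p r).union (isCompact_closedBall q r))
  have hKU : K ⊆ Set.Ioo (0:ℝ) 1 ×ˢ U := by
    rintro ⟨s, y⟩ ⟨hs, hy | hy⟩
    · exact ⟨(hball₁ s hs y hy).1, (hball₁ s hs y hy).2.1⟩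
    · exact ⟨(hball₂ s hs y hy).1, (hball₂ s hs y hy).2.1⟩
  have hfK : tsupport f ⊆ K := by
    refine closure_minimal (fun x hx => ?_) hK.isClosed
    obtain ⟨h₁, h₂⟩ := mul_ne_zero_iff.1 (Function.mem_support.1 hx)
    refine ⟨hχ _ h₁, ?_⟩
    by_cases h₃ : φ.normed volume x.2 = 0
    · exact Or.inr (hψ _ fun h₄ => h₂ (by rw [h₃, h₄, sub_zero]))
    · exact Or.inl (hφ _ h₃)
  have hfs : ContDiff ℝ (⊤ : ℕ∞) f :=
    (χ.contDiff.comp contDiff_fst).mul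
      ((φ.contDiff_normed.comp contDiff_snd).sub (ψ.contDiff_normed.comp contDiff_snd))
  have hfc : HasCompactSupport f := hK.of_isClosed_subset (isClosed_tsupport f) hfK
  have hfU : tsupport f ⊆ Set.Ioo (0:ℝ) 1 ×ˢ U := hfK.trans hKU
  have hf0 : ∀ x, x ∉ Set.Ioo (0:ℝ) 1 ×ˢ U → f x = 0 := fun x hx =>
    image_eq_zero_of_notMem_tsupport fun hx' => hx (hfU hx')
  let G : ℝ × (Fin n → ℝ) → ℝ := fun x => f x * h x
  have hGcont : Continuous G := continuous_of_tsupport fun x hx =>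
    hfs.continuous.continuousAt.mul
      (hco.continuousAt ((isOpen_Ioo.prod hU).mem_nhds (hfU (tsupport_mul_subset_left hx))))
  have hGc : HasCompactSupport G := hfc.mul_right
  have hGφ : ∀ s y, 0 ≤ χ s * φ.normed volume y * h (s, y) := fun s y => by
    by_cases hs : χ s = 0
    · simp [hs]
    by_cases hy : φ.normed volume y = 0
    · simp [hy]
    exact mul_nonneg (mul_nonneg χ.nonneg (φ.nonneg_normed y))
      (hball₁ s (hχ s hs) y (hφ y hy)).2.2.le
  have hGψ : ∀ s y, 0 ≤ χ s * ψ.normed volume y * -h (s, y) := fun s y => by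
    by_cases hs : χ s = 0
    · simp [hs]
    by_cases hy : ψ.normed volume y = 0
    · simp [hy]
    exact mul_nonneg (mul_nonneg χ.nonneg (ψ.nonneg_normed y))
      (hball₂ s (hχ s hs) y (hψ y hy)).2.2.le
  have hGsplit : ∀ s y, G (s, y) =
      χ s * φ.normed volume y * h (s, y) + χ s * ψ.normed volume y * -h (s, y) := fun s y => by
    simp only [G, f]
    ring
  have hGnonneg : 0 ≤ G := fun ⟨s, y⟩ => by
    rw [hGsplit]
    exact add_nonneg (hGφ s y) (hGψ s y)
  have hGne : G (t, p) ≠ 0 := by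
    have hχt : 0 < χ t := χ.pos_of_mem_ball (Metric.mem_ball_self hr0)
    have hφp : 0 < φ.normed volume p :=
      div_pos (φ.pos_of_mem_ball (Metric.mem_ball_self hr0)) φ.integral_pos
    rw [hGsplit]
    exact (add_pos_of_pos_of_nonneg (mul_pos (mul_pos hχt hφp) htp) (hGψ t p)).ne'
  refine ⟨f, hfs, hfc, hfU, fun θ => ?_, ?_⟩
  · rw [setIntegral_eq_integral_of_forall_compl_eq_zero (f := fun y => f (θ, y))
      fun y hy => hf0 _ fun hx => hy hx.2]
    simp only [f]
    rw [integral_const_mul, integral_sub φ.integrable_normed ψ.integrable_normed,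
      φ.integral_normed, ψ.integral_normed, sub_self, mul_zero]
  · have hU' : ∀ θ : ℝ, ∫ y in U, f (θ, y) * h (θ, y) = ∫ y, G (θ, y) := fun θ =>
      setIntegral_eq_integral_of_forall_compl_eq_zero fun y hy => by
        rw [hf0 _ fun hx => hy hx.2, zero_mul]
    simp_rw [hU']
    rw [intervalIntegral.integral_of_le zero_le_one,
      setIntegral_eq_integral_of_forall_compl_eq_zero fun θ hθ => by
        have : ∀ y, G (θ, y) = 0 := fun y => by
          simp only [G]
          rw [hf0 _ fun hx => hθ (Set.Ioo_subset_Ioc_self hx.1), zero_mul]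
        simp [this],
      ← integral_prod G (hGcont.integrable_of_hasCompactSupport hGc)]
    exact hGcont.integral_pos_of_hasCompactSupport_nonneg_nonzero hGc hGnonneg hGne
end
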